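/- arXiv:2408.04346 — 2 statements merged into one kernel-verified Lean document; each statement's English description precedes it below -/
import Mathlib

section
/- Let n ≥ 3, p ≥ 2 real, q = p/(p−1), and let f : S_p^{n−1} → ℝ be 1-Lipschitz with respect to the ℓ_p-norm. Then for every t ≥ 0, ν_{p,n}( |f − ∫ f dν_{p,n}| ≥ t ) ≤ 2 (p+1)^{1−2/p} exp( − ((q−1)^p / (3^{p−1} · 8^p · q)) n t^p ). -/
open MeasureTheory Real

/-- The `ℓ_p`-norm on `ℝⁿ` (realized as Euclidean space, so that Hausdorff measure is the
one associated with the Euclidean metric). -/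
noncomputable def lpNormE (p : ℝ) {n : ℕ} (x : EuclideanSpace ℝ (Fin n)) : ℝ :=
  (∑ i, |x i| ^ p) ^ (1 / p)

/-- The surface measure `ν_{p,n}`: the normalized `(n-1)`-dimensional Hausdorff measure on
the `ℓ_p`-unit sphere. -/
noncomputable def surfaceMeasure (p : ℝ) (n : ℕ) : Measure (EuclideanSpace ℝ (Fin n)) :=
  (μH[(n : ℝ) - 1] {x : EuclideanSpace ℝ (Fin n) | lpNormE p x = 1})⁻¹ •
    (μH[(n : ℝ) - 1]).restrict {x : EuclideanSpace ℝ (Fin n) | lpNormE p x = 1}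

section
open MeasureTheory Real
lemma bm_compact {K L C : Set ℝ} (hK : IsCompact K) (hL : IsCompact L) (hKn : K.Nonempty)
    (hLn : L.Nonempty) (h : ∀ a ∈ K, ∀ b ∈ L, (a + b) / 2 ∈ C) :
    volume K + volume L ≤ 2 * volume C := by
  obtain ⟨a, ha⟩ := hK.exists_isGreatest hKn
  obtain ⟨b, hb⟩ := hL.exists_isLeast hLn
  have h1 : volume ((fun x => (2:ℝ) * x + (-b)) ⁻¹' K) = volume K / 2 := by
    have : (fun x => (2:ℝ) * x + (-b)) ⁻¹' K
        = (fun x => (2:ℝ) * x) ⁻¹' ((fun x => x + (-b)) ⁻¹' K) := rfl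
    rw [this, Real.volume_preimage_mul_left (by norm_num), measure_preimage_add_right,
      ENNReal.div_eq_inv_mul, abs_of_pos (by norm_num), ENNReal.ofReal_inv_of_pos (by norm_num)]
    simp
  have h2 : volume ((fun x => (2:ℝ) * x + (-a)) ⁻¹' L) = volume L / 2 := by
    have : (fun x => (2:ℝ) * x + (-a)) ⁻¹' L
        = (fun x => (2:ℝ) * x) ⁻¹' ((fun x => x + (-a)) ⁻¹' L) := rfl
    rw [this, Real.volume_preimage_mul_left (by norm_num), measure_preimage_add_right,
      ENNReal.div_eq_inv_mul, abs_of_pos (by norm_num), ENNReal.ofReal_inv_of_pos (by norm_num)]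
    simp
  have hm : MeasurableSet ((fun x => (2:ℝ) * x + (-a)) ⁻¹' L) :=
    hL.measurableSet.preimage (by fun_prop)
  have h3 : volume ((fun x => (2:ℝ) * x + (-b)) ⁻¹' K ∪ (fun x => (2:ℝ) * x + (-a)) ⁻¹' L)
      = volume K / 2 + volume L / 2 := by
    rw [measure_union₀ hm.nullMeasurableSet, h1, h2]
    refine measure_mono_null (t := {(a + b) / 2}) ?_ (by simp)
    rintro x ⟨hx1, hx2⟩
    have e1 := ha.2 hx1
    have e2 := hb.2 hx2
    simp only [Set.mem_singleton_iff]
    linarith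
  have h4 : (fun x => (2:ℝ) * x + (-b)) ⁻¹' K ∪ (fun x => (2:ℝ) * x + (-a)) ⁻¹' L ⊆ C := by
    rintro x (hx | hx)
    · have := h _ hx _ hb.1
      convert this using 1; ring
    · have := h _ ha.1 _ hx
      convert this using 1; ring
  have h5 := measure_mono (μ := volume) h4
  rw [h3, ← ENNReal.add_div] at h5
  rw [mul_comm]
  exact (ENNReal.div_le_iff_le_mul (by simp) (by simp)).1 h5

lemma bm_one {A B C : Set ℝ} (hA : MeasurableSet A) (hB : MeasurableSet B) (hAn : A.Nonempty)
    (hBn : B.Nonempty) (h : ∀ a ∈ A, ∀ b ∈ B, (a + b) / 2 ∈ C) :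
    volume A + volume B ≤ 2 * volume C := by
  obtain ⟨a, ha⟩ := hAn
  obtain ⟨b, hb⟩ := hBn
  have key : ∀ K L : Set ℝ, K ⊆ A → L ⊆ B → IsCompact K → IsCompact L →
      volume K + volume L ≤ 2 * volume C := by
    intro K L hKA hLB hK hL
    have := bm_compact (C := C) (hK.insert a) (hL.insert b) (Set.insert_nonempty _ _)
      (Set.insert_nonempty _ _) (fun x hx y hy => h x (Set.insert_subset ha hKA hx) y
        (Set.insert_subset hb hLB hy))
    refine le_trans (add_le_add (measure_mono ?_) (measure_mono ?_)) this
    · exact Set.subset_insert _ _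
    · exact Set.subset_insert _ _
  rw [hA.measure_eq_iSup_isCompact, hB.measure_eq_iSup_isCompact]
  simp only [iSup_and']
  exact ENNReal.biSup_add_biSup_le' ⟨∅, by simp⟩ ⟨∅, by simp⟩
    fun K hK L hL => key K L hK.1 hL.1 hK.2 hL.2

lemma pl_one_norm (f g h : ℝ → ℝ) (hf : Measurable f) (hg : Measurable g) (hh : Measurable h)
    (f0 : ∀ x, 0 ≤ f x) (g0 : ∀ x, 0 ≤ g x) (h0 : ∀ x, 0 ≤ h x)
    (f1 : ∀ x, f x ≤ 1) (g1 : ∀ x, g x ≤ 1)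
    (fs : ∀ t < 1, ∃ x, t < f x) (gs : ∀ t < 1, ∃ x, t < g x)
    (H : ∀ x y, f x * g y ≤ h ((x + y) / 2) ^ 2) :
    (∫⁻ x, ENNReal.ofReal (f x)) + (∫⁻ x, ENNReal.ofReal (g x))
      ≤ 2 * ∫⁻ x, ENNReal.ofReal (h x) := by
  rw [lintegral_eq_lintegral_meas_lt _ (.of_forall f0) hf.aemeasurable,
    lintegral_eq_lintegral_meas_lt _ (.of_forall g0) hg.aemeasurable,
    lintegral_eq_lintegral_meas_lt _ (.of_forall h0) hh.aemeasurable]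
  have mono : ∀ k : ℝ → ℝ, Measurable fun t => volume {a | t < k a} := fun k =>
    Antitone.measurable fun s t hst => measure_mono fun a ha => lt_of_le_of_lt hst ha
  rw [← lintegral_add_left (mono f), ← lintegral_const_mul _ (mono h)]
  refine setLIntegral_mono' measurableSet_Ioi fun t ht => ?_
  have ht : 0 < t := ht
  rcases lt_or_ge t 1 with h1 | h1
  · refine bm_one (measurableSet_lt measurable_const hf) (measurableSet_lt measurable_const hg)
      (fs t h1) (gs t h1) ?_
    intro a ha b hb
    have ha : t < f a := ha
    have hb : t < g b := hb
    have := H a b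
    have : t * t < h ((a + b) / 2) ^ 2 := lt_of_lt_of_le (mul_lt_mul'' ha hb ht.le ht.le) this
    exact lt_of_pow_lt_pow_left₀ 2 (h0 _) (by nlinarith)
  · have e1 : {a | t < f a} = ∅ := by
      ext a; simp; exact (f1 a).trans h1
    have e2 : {a | t < g a} = ∅ := by
      ext a; simp; exact (g1 a).trans h1
    simp [e1, e2]

lemma ennreal_amgm (a b : ENNReal) : 4 * (a * b) ≤ (a + b) ^ 2 := by
  rcases eq_or_ne a ⊤ with rfl | ha
  · simp
  rcases eq_or_ne b ⊤ with rfl | hb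
  · simp
  lift a to NNReal using ha
  lift b to NNReal using hb
  norm_cast
  have : (4 * (a * b) : ℝ) ≤ (a + b) ^ 2 := by nlinarith [sq_nonneg ((a:ℝ) - b)]
  exact_mod_cast this

/-- Bounded case. -/
lemma pl_one_bdd (f g h : ℝ → ENNReal) (hf : Measurable f) (hg : Measurable g)
    (hh : Measurable h) (fb : ⨆ x, f x ≠ ⊤) (gb : ⨆ x, g x ≠ ⊤)
    (H : ∀ x y, f x * g y ≤ h ((x + y) / 2) ^ 2) :
    (∫⁻ x, f x) * (∫⁻ x, g x) ≤ (∫⁻ x, h x) ^ 2 := by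
  set a := ⨆ x, f x with ha
  set b := ⨆ x, g x with hb
  rcases eq_or_ne a 0 with ha0 | ha0
  · have : ∀ x, f x = 0 := fun x => le_antisymm (ha0 ▸ le_iSup f x) bot_le
    simp [this]
  rcases eq_or_ne b 0 with hb0 | hb0
  · have : ∀ x, g x = 0 := fun x => le_antisymm (hb0 ▸ le_iSup g x) bot_le
    simp [this]
  have fle : ∀ x, f x ≤ a := le_iSup f
  have gle : ∀ x, g x ≤ b := le_iSup g
  have fnt : ∀ x, f x ≠ ⊤ := fun x => ne_top_of_le_ne_top fb (fle x)
  have gnt : ∀ x, g x ≠ ⊤ := fun x => ne_top_of_le_ne_top gb (gle x)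
  have aR : 0 < a.toReal := ENNReal.toReal_pos ha0 fb
  have bR : 0 < b.toReal := ENNReal.toReal_pos hb0 gb
  set c := Real.sqrt (a.toReal * b.toReal) with hc
  have cR : 0 < c := Real.sqrt_pos.2 (mul_pos aR bR)
  have c2 : c ^ 2 = a.toReal * b.toReal := Real.sq_sqrt (mul_pos aR bR).le
  set h' : ℝ → ENNReal := fun x => min (h x) (ENNReal.ofReal c) with hh'
  have hle : ∀ x, h' x ≠ ⊤ := fun x => ne_top_of_le_ne_top ENNReal.ofReal_ne_top (min_le_right _ _)
  have hm' : Measurable h' := hh.min measurable_const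
  have key := pl_one_norm (fun x => (f x).toReal / a.toReal) (fun x => (g x).toReal / b.toReal)
    (fun x => (h' x).toReal / c) (hf.ennreal_toReal.div_const _) (hg.ennreal_toReal.div_const _)
    (hm'.ennreal_toReal.div_const _) (fun x => by positivity) (fun x => by positivity)
    (fun x => by positivity)
    (fun x => by rw [div_le_one aR]; exact ENNReal.toReal_mono fb (fle x))
    (fun x => by rw [div_le_one bR]; exact ENNReal.toReal_mono gb (gle x))
    (by
      intro t ht
      by_contra! hcon
      have : a ≤ ENNReal.ofReal (t * a.toReal) := by
        refine iSup_le fun x => ?_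
        rw [← ENNReal.ofReal_toReal (fnt x)]
        exact ENNReal.ofReal_le_ofReal (by have := hcon x; rwa [div_le_iff₀ aR] at this)
      have h2 : (0:ℝ) ≤ t := le_trans (by positivity) (hcon 0)
      have := ENNReal.toReal_mono ENNReal.ofReal_ne_top this
      rw [ENNReal.toReal_ofReal (by positivity)] at this
      nlinarith)
    (by
      intro t ht
      by_contra! hcon
      have : b ≤ ENNReal.ofReal (t * b.toReal) := by
        refine iSup_le fun x => ?_
        rw [← ENNReal.ofReal_toReal (gnt x)]
        exact ENNReal.ofReal_le_ofReal (by have := hcon x; rwa [div_le_iff₀ bR] at this)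
      have h2 : (0:ℝ) ≤ t := le_trans (by positivity) (hcon 0)
      have := ENNReal.toReal_mono ENNReal.ofReal_ne_top this
      rw [ENNReal.toReal_ofReal (by positivity)] at this
      nlinarith)
    (by
      intro x y
      rw [div_mul_div_comm, div_pow, c2]
      refine div_le_div_of_nonneg_right ?_ (by positivity)
      rw [← ENNReal.toReal_mul, ← ENNReal.toReal_pow]
      refine ENNReal.toReal_mono (ENNReal.pow_ne_top (hle _)) ?_
      have : h' ((x + y) / 2) ^ 2 = min (h ((x + y) / 2) ^ 2) (ENNReal.ofReal c ^ 2) :=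
        (pow_left_mono 2).map_min
      rw [this]
      refine le_min (H x y) ?_
      rw [← ENNReal.ofReal_pow cR.le, c2, ENNReal.ofReal_mul aR.le, ENNReal.ofReal_toReal fb,
        ENNReal.ofReal_toReal gb]
      exact mul_le_mul' (fle x) (gle y))
  have conv : ∀ (k : ℝ → ENNReal) (d : ℝ), Measurable k → 0 < d → (∀ x, k x ≠ ⊤) →
      ∫⁻ x, k x = ENNReal.ofReal d * ∫⁻ x, ENNReal.ofReal ((k x).toReal / d) := by
    intro k d hk hd hkt
    rw [← lintegral_const_mul _ (hk.ennreal_toReal.div_const _).ennreal_ofReal]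
    refine lintegral_congr fun x => ?_
    rw [← ENNReal.ofReal_mul hd.le, mul_div_cancel₀ _ hd.ne', ENNReal.ofReal_toReal (hkt x)]
  have hh'' : ∫⁻ x, h' x ≤ ∫⁻ x, h x := lintegral_mono fun x => min_le_left _ _
  refine le_trans ?_ (pow_le_pow_left' hh'' 2)
  rw [conv f _ hf aR fnt, conv g _ hg bR gnt, conv h' _ hm' cR hle]
  set F := ∫⁻ x, ENNReal.ofReal ((f x).toReal / a.toReal)
  set G := ∫⁻ x, ENNReal.ofReal ((g x).toReal / b.toReal)
  set Hh := ∫⁻ x, ENNReal.ofReal ((h' x).toReal / c)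
  have k2 : F * G ≤ Hh ^ 2 := by
    have e1 := (ennreal_amgm F G).trans (pow_le_pow_left' key 2)
    have e2 : (2 * Hh) ^ 2 = 4 * Hh ^ 2 := by ring
    rw [e2] at e1
    exact (ENNReal.mul_le_mul_iff_right (by simp) (by simp)).1 e1
  calc ENNReal.ofReal a.toReal * F * (ENNReal.ofReal b.toReal * G)
      = ENNReal.ofReal a.toReal * ENNReal.ofReal b.toReal * (F * G) := by ring
    _ ≤ ENNReal.ofReal a.toReal * ENNReal.ofReal b.toReal * Hh ^ 2 := by gcongr
    _ = (ENNReal.ofReal c * Hh) ^ 2 := by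
      rw [mul_pow, ← ENNReal.ofReal_pow cR.le, c2, ENNReal.ofReal_mul aR.le]

lemma pl_one (f g h : ℝ → ENNReal) (hf : Measurable f) (hg : Measurable g)
    (hh : Measurable h) (H : ∀ x y, f x * g y ≤ h ((x + y) / 2) ^ 2) :
    (∫⁻ x, f x) * (∫⁻ x, g x) ≤ (∫⁻ x, h x) ^ 2 := by
  have tr : ∀ k : ℝ → ENNReal, Measurable k → ∫⁻ x, k x = ⨆ N : ℕ, ∫⁻ x, min (k x) (N : ENNReal) := by
    intro k hk
    rw [← lintegral_iSup (fun N => hk.min measurable_const)]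
    · refine lintegral_congr fun x => ?_
      rw [← inf_iSup_eq, ENNReal.iSup_natCast, inf_top_eq]
    · intro M N hMN x
      exact min_le_min le_rfl (by exact_mod_cast hMN)
  have bd : ∀ (k : ℝ → ENNReal) (N : ℕ), ⨆ x, min (k x) (N : ENNReal) ≠ ⊤ := fun k N =>
    ne_top_of_le_ne_top (ENNReal.natCast_ne_top N) (iSup_le fun x => min_le_right _ _)
  rw [tr f hf, tr g hg, ENNReal.iSup_mul]
  refine iSup_le fun M => ?_
  rw [ENNReal.mul_iSup]
  refine iSup_le fun N => pl_one_bdd _ _ h (hf.min measurable_const) (hg.min measurable_const) hh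
      (bd f M) (bd g N) fun x y => le_trans (mul_le_mul' (min_le_left _ _) (min_le_left _ _)) (H x y)

theorem prekopa_leindler (n : ℕ) (f g h : (Fin n → ℝ) → ENNReal) (hf : Measurable f)
    (hg : Measurable g) (hh : Measurable h)
    (H : ∀ x y, f x * g y ≤ h ((2:ℝ)⁻¹ • (x + y)) ^ 2) :
    (∫⁻ x, f x) * (∫⁻ x, g x) ≤ (∫⁻ x, h x) ^ 2 := by
  induction n with
  | zero =>
    have : ∀ k : (Fin 0 → ℝ) → ENNReal, ∫⁻ x, k x = k 0 := by
      intro k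
      rw [volume_pi, Measure.pi_of_empty (x := 0)]
      simp
    rw [this, this, this]
    have := H 0 0
    simpa using this
  | succ n ih =>
    set e := (MeasurableEquiv.piFinSuccAbove (fun _ : Fin (n+1) => ℝ) 0) with he
    have mp := (volume_preserving_piFinSuccAbove (fun _ : Fin (n+1) => ℝ) 0).symm
    have conv : ∀ k : (Fin (n+1) → ℝ) → ENNReal, Measurable k →
        ∫⁻ x, k x = ∫⁻ s : ℝ, ∫⁻ y : Fin n → ℝ, k (e.symm (s, y)) := by
      intro k hk
      rw [← mp.lintegral_comp hk]
      exact lintegral_prod _ (hk.comp e.symm.measurable).aemeasurable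
    have meas : ∀ k : (Fin (n+1) → ℝ) → ENNReal, Measurable k →
        Measurable fun s : ℝ => ∫⁻ y : Fin n → ℝ, k (e.symm (s, y)) := fun k hk =>
      Measurable.lintegral_prod_right' (f := fun z => k (e.symm z)) (hk.comp e.symm.measurable)
    rw [conv f hf, conv g hg, conv h hh]
    refine pl_one _ _ _ (meas f hf) (meas g hg) (meas h hh) fun s t => ?_
    refine ih _ _ _ (hf.comp (e.symm.measurable.comp measurable_prodMk_left))
      (hg.comp (e.symm.measurable.comp measurable_prodMk_left))
      (hh.comp (e.symm.measurable.comp measurable_prodMk_left)) fun x y => ?_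
    refine (H _ _).trans (le_of_eq ?_)
    congr 2
    ext i
    refine Fin.cases ?_ (fun j => ?_) i
    · simp [he, MeasurableEquiv.piFinSuccAbove, Fin.insertNthEquiv]; ring
    · simp [he, MeasurableEquiv.piFinSuccAbove, Fin.insertNthEquiv]; ring

end

section
open MeasureTheory Real
open scoped Pointwise
/-- `ℓ_p`-norm to the power `p`. -/
noncomputable def sP (p : ℝ) {n : ℕ} (x : EuclideanSpace ℝ (Fin n)) : ℝ := ∑ i, |x i| ^ p

lemma sP_nonneg (p : ℝ) {n : ℕ} (x : EuclideanSpace ℝ (Fin n)) : 0 ≤ sP p x :=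
  Finset.sum_nonneg fun _ _ => rpow_nonneg (abs_nonneg _) _

lemma lpN_def (p : ℝ) {n : ℕ} (x : EuclideanSpace ℝ (Fin n)) : lpNormE p x = sP p x ^ (1 / p) := rfl

lemma lpN_nonneg (p : ℝ) {n : ℕ} (x : EuclideanSpace ℝ (Fin n)) : 0 ≤ lpNormE p x :=
  rpow_nonneg (sP_nonneg p x) _

lemma lpN_rpow {p : ℝ} (hp : 2 ≤ p) {n : ℕ} (x : EuclideanSpace ℝ (Fin n)) :
    lpNormE p x ^ p = sP p x := by
  rw [lpN_def, ← rpow_mul (sP_nonneg p x), one_div_mul_cancel (by linarith), rpow_one]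

lemma lpN_smul {p : ℝ} (hp : 2 ≤ p) {n : ℕ} (c : ℝ) (x : EuclideanSpace ℝ (Fin n)) :
    lpNormE p (c • x) = |c| * lpNormE p x := by
  have : sP p (c • x) = |c| ^ p * sP p x := by
    simp only [sP, Finset.mul_sum]
    refine Finset.sum_congr rfl fun i _ => ?_
    rw [← mul_rpow (abs_nonneg _) (abs_nonneg _), ← abs_mul]; rfl
  rw [lpN_def, this, mul_rpow (by positivity) (sP_nonneg p x), ← rpow_mul (abs_nonneg _),
    mul_one_div_cancel (by linarith), rpow_one, lpN_def]

lemma sP_smul {p : ℝ} (hp : 2 ≤ p) {n : ℕ} (c : ℝ) (x : EuclideanSpace ℝ (Fin n)) :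
    sP p (c • x) = |c| ^ p * sP p x := by
  rw [← lpN_rpow hp, lpN_smul hp, mul_rpow (abs_nonneg _) (lpN_nonneg _ _), lpN_rpow hp]

lemma lpN_add_le {p : ℝ} (hp : 2 ≤ p) {n : ℕ} (x y : EuclideanSpace ℝ (Fin n)) :
    lpNormE p (x + y) ≤ lpNormE p x + lpNormE p y := by
  have := Real.Lp_add_le Finset.univ (fun i => x i) (fun i => y i) (p := p) (by linarith)
  exact this

lemma lpN_neg {p : ℝ} (hp : 2 ≤ p) {n : ℕ} (x : EuclideanSpace ℝ (Fin n)) :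
    lpNormE p (-x) = lpNormE p x := by
  have := lpN_smul hp (-1) x
  simpa using this

lemma sP_continuous {p : ℝ} (hp : 2 ≤ p) {n : ℕ} :
    Continuous (sP p : EuclideanSpace ℝ (Fin n) → ℝ) := by
  unfold sP
  refine continuous_finsetSum _ fun i _ => ?_
  refine Continuous.rpow_const (by fun_prop) fun x => Or.inr (by linarith)

lemma lpN_continuous {p : ℝ} (hp : 2 ≤ p) {n : ℕ} :
    Continuous (lpNormE p : EuclideanSpace ℝ (Fin n) → ℝ) := by
  have : (lpNormE p : EuclideanSpace ℝ (Fin n) → ℝ) = fun x => sP p x ^ (1 / p) := rfl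
  rw [this]
  exact (sP_continuous hp).rpow_const fun x => Or.inr (by positivity)

lemma lpN_eq_zero {p : ℝ} (hp : 2 ≤ p) {n : ℕ} {x : EuclideanSpace ℝ (Fin n)} :
    lpNormE p x = 0 ↔ x = 0 := by
  constructor
  · intro h
    have h1 : sP p x = 0 := by
      rw [← lpN_rpow hp, h, zero_rpow (by linarith)]
    ext i
    have := (Finset.sum_eq_zero_iff_of_nonneg (fun i _ => rpow_nonneg (abs_nonneg (x i)) p)).1 h1 i
      (Finset.mem_univ _)
    rw [rpow_eq_zero (abs_nonneg _) (by linarith)] at this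
    simpa using this
  · rintro rfl
    have := lpN_smul hp 0 (0 : EuclideanSpace ℝ (Fin n))
    simpa using this

lemma lpN_pos {p : ℝ} (hp : 2 ≤ p) {n : ℕ} {x : EuclideanSpace ℝ (Fin n)} (hx : x ≠ 0) :
    0 < lpNormE p x :=
  lt_of_le_of_ne (lpN_nonneg p x) fun h => hx ((lpN_eq_zero hp).1 h.symm)

lemma clarkson_real {p : ℝ} (hp : 2 ≤ p) (a b : ℝ) :
    |2⁻¹ * (a + b)| ^ p + |2⁻¹ * (a - b)| ^ p ≤ (|a| ^ p + |b| ^ p) / 2 := by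
  have sq : ∀ c : ℝ, |c| ^ p = (c ^ 2) ^ (p / 2) := by
    intro c
    rw [← sq_abs, ← rpow_natCast, ← rpow_mul (abs_nonneg _)]
    congr 1; push_cast; ring
  rw [sq, sq, sq a, sq b]
  refine (Real.add_rpow_le_rpow_add (sq_nonneg _) (sq_nonneg _) (by linarith)).trans ?_
  have h1 := (convexOn_rpow (p := p / 2) (by linarith)).2 (Set.mem_Ici.2 (sq_nonneg a))
    (Set.mem_Ici.2 (sq_nonneg b)) (show (0:ℝ) ≤ 1/2 by norm_num) (show (0:ℝ) ≤ 1/2 by norm_num)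
    (by norm_num)
  simp only [smul_eq_mul] at h1
  have e : (2⁻¹ * (a + b)) ^ 2 + (2⁻¹ * (a - b)) ^ 2 = 1 / 2 * a ^ 2 + 1 / 2 * b ^ 2 := by ring
  rw [e]
  linarith

lemma clarkson {p : ℝ} (hp : 2 ≤ p) {n : ℕ} (x y : EuclideanSpace ℝ (Fin n)) :
    sP p ((2:ℝ)⁻¹ • (x + y)) + sP p ((2:ℝ)⁻¹ • (x - y)) ≤ (sP p x + sP p y) / 2 := by
  simp only [sP, ← Finset.sum_add_distrib, Finset.sum_div]
  exact Finset.sum_le_sum fun i _ => clarkson_real hp (x i) (y i)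

lemma mid_bound_aux {p : ℝ} (hp : 2 ≤ p) {n : ℕ} (x x' : EuclideanSpace ℝ (Fin n))
    (hx : lpNormE p x = 1) (r r' : ℝ) (h0 : 0 ≤ r') (hr : r' ≤ r) (h1 : r ≤ 1) :
    lpNormE p ((2:ℝ)⁻¹ • (r • x + r' • x')) ≤ max (1/2) (lpNormE p ((2:ℝ)⁻¹ • (x + x'))) := by
  have e : (2:ℝ)⁻¹ • (r • x + r' • x') = ((r - r') / 2) • x + r' • ((2:ℝ)⁻¹ • (x + x')) := by
    module
  rw [e]
  refine (lpN_add_le hp _ _).trans ?_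
  rw [lpN_smul hp, lpN_smul hp r', hx, abs_of_nonneg (by linarith), abs_of_nonneg h0]
  set a := lpNormE p ((2:ℝ)⁻¹ • (x + x'))
  have m1 := le_max_left (1/2) a
  have m2 := le_max_right (1/2) a
  set m := max (1/2) a
  have : r' * a ≤ r' * m := by gcongr
  nlinarith

lemma mid_bound {p : ℝ} (hp : 2 ≤ p) {n : ℕ} (x x' : EuclideanSpace ℝ (Fin n))
    (hx : lpNormE p x = 1) (hx' : lpNormE p x' = 1) (r r' : ℝ) (h0 : 0 ≤ r) (h0' : 0 ≤ r')
    (h1 : r ≤ 1) (h1' : r' ≤ 1) :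
    lpNormE p ((2:ℝ)⁻¹ • (r • x + r' • x')) ≤ max (1/2) (lpNormE p ((2:ℝ)⁻¹ • (x + x'))) := by
  rcases le_total r' r with h | h
  · exact mid_bound_aux hp x x' hx r r' h0' h h1
  · have := mid_bound_aux hp x' x hx' r' r h0 h h1'
    rwa [add_comm (r' • x'), add_comm x'] at this

lemma mid_bound2 {p : ℝ} (hp : 2 ≤ p) {n : ℕ} (x x' : EuclideanSpace ℝ (Fin n))
    (hx : lpNormE p x = 1) (hx' : lpNormE p x' = 1) (r r' : ℝ) (h0 : 0 ≤ r) (h0' : 0 ≤ r')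
    (h1 : r ≤ 1) (h1' : r' ≤ 1) (t : ℝ) (ht : 0 ≤ t) (hd : t ≤ lpNormE p (x - x')) :
    lpNormE p ((2:ℝ)⁻¹ • (r • x + r' • x')) ≤ exp (-((3/4) * (t/2) ^ p / p)) := by
  have p0 : 0 < p := by linarith
  have ht2 : t ≤ 2 := by
    have := lpN_add_le hp x (-x')
    rw [lpN_neg hp, hx, hx', ← sub_eq_add_neg] at this
    linarith
  have hu : (t/2) ^ p ≤ 1 := rpow_le_one (by linarith) (by linarith) p0.le
  have hu0 : 0 ≤ (t/2) ^ p := by positivity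
  have key : lpNormE p ((2:ℝ)⁻¹ • (r • x + r' • x')) ^ p ≤ 1 - (3/4) * (t/2) ^ p := by
    refine (rpow_le_rpow (lpN_nonneg _ _) (mid_bound hp x x' hx hx' r r' h0 h0' h1 h1') p0.le).trans ?_
    rcases max_cases (1/2) (lpNormE p ((2:ℝ)⁻¹ • (x + x'))) with ⟨h, _⟩ | ⟨h, _⟩
    · rw [h]
      have : (1/2 : ℝ) ^ p ≤ (1/2) ^ (2:ℝ) := rpow_le_rpow_of_exponent_ge (by norm_num) (by norm_num) hp
      norm_num at this ⊢
      linarith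
    · rw [h, lpN_rpow hp]
      have c := clarkson hp x x'
      have e : sP p ((2:ℝ)⁻¹ • (x - x')) = (lpNormE p (x - x') / 2) ^ p := by
        rw [← lpN_rpow hp, lpN_smul hp, abs_of_pos (by norm_num)]; congr 1; ring
      rw [e, ← lpN_rpow hp x, ← lpN_rpow hp x', hx, hx', one_rpow] at c
      have : (t/2) ^ p ≤ (lpNormE p (x - x') / 2) ^ p :=
        rpow_le_rpow (by positivity) (by linarith) p0.le
      linarith
  have k2 : lpNormE p ((2:ℝ)⁻¹ • (r • x + r' • x')) ^ p ≤ exp (-((3/4) * (t/2) ^ p / p)) ^ p := by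
    rw [← exp_mul]
    have := add_one_le_exp (-((3/4) * (t/2) ^ p))
    have e : -((3/4) * (t/2) ^ p / p) * p = -((3/4) * (t/2) ^ p) := by field_simp
    rw [e]; linarith
  exact (rpow_le_rpow_iff (lpN_nonneg _ _) (exp_pos _).le p0).1 k2

/-- the solid cone over (the part on the sphere of) `A`. -/
def coneS (p : ℝ) {n : ℕ} (A : Set (EuclideanSpace ℝ (Fin n))) : Set (EuclideanSpace ℝ (Fin n)) :=
  {x | 0 < lpNormE p x ∧ lpNormE p x ≤ 1 ∧ (lpNormE p x)⁻¹ • x ∈ A}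

lemma lpN_normalize {p : ℝ} (hp : 2 ≤ p) {n : ℕ} {x : EuclideanSpace ℝ (Fin n)}
    (hx : 0 < lpNormE p x) : lpNormE p ((lpNormE p x)⁻¹ • x) = 1 := by
  rw [lpN_smul hp, abs_of_pos (inv_pos.2 hx), inv_mul_cancel₀ hx.ne']

lemma normalize_measurable {p : ℝ} (hp : 2 ≤ p) {n : ℕ} :
    Measurable (fun x : EuclideanSpace ℝ (Fin n) => (lpNormE p x)⁻¹ • x) :=
  (lpN_continuous hp).measurable.inv.smul measurable_id

lemma coneS_measurable {p : ℝ} (hp : 2 ≤ p) {n : ℕ} {A : Set (EuclideanSpace ℝ (Fin n))}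
    (hA : MeasurableSet A) : MeasurableSet (coneS p A) :=
  (measurableSet_lt measurable_const (lpN_continuous hp).measurable).inter
    ((measurableSet_le (lpN_continuous hp).measurable measurable_const).inter
      (normalize_measurable hp hA))

lemma pl_eucl (n : ℕ) (f g h : EuclideanSpace ℝ (Fin n) → ENNReal) (hf : Measurable f)
    (hg : Measurable g) (hh : Measurable h)
    (H : ∀ x y, f x * g y ≤ h ((2:ℝ)⁻¹ • (x + y)) ^ 2) :
    (∫⁻ x, f x) * (∫⁻ x, g x) ≤ (∫⁻ x, h x) ^ 2 := by
  have mp := PiLp.volume_preserving_toLp (Fin n)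
  rw [← mp.lintegral_comp hf, ← mp.lintegral_comp hg, ← mp.lintegral_comp hh]
  exact prekopa_leindler n _ _ _ (hf.comp mp.measurable) (hg.comp mp.measurable)
    (hh.comp mp.measurable) fun x y => H _ _

lemma ball_scale {p : ℝ} (hp : 2 ≤ p) {n : ℕ} {r : ℝ} (hr : 0 < r) :
    volume {x : EuclideanSpace ℝ (Fin n) | lpNormE p x ≤ r}
      = ENNReal.ofReal (r ^ n) * volume {x : EuclideanSpace ℝ (Fin n) | lpNormE p x ≤ 1} := by
  have : {x : EuclideanSpace ℝ (Fin n) | lpNormE p x ≤ r}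
      = r • {x : EuclideanSpace ℝ (Fin n) | lpNormE p x ≤ 1} := by
    ext x
    rw [Set.mem_smul_set_iff_inv_smul_mem₀ hr.ne']
    simp only [Set.mem_setOf_eq]
    rw [lpN_smul hp, abs_of_pos (inv_pos.2 hr), inv_mul_le_iff₀ hr, mul_one]
  rw [this, Measure.addHaar_smul, finrank_euclideanSpace_fin, abs_of_pos (by positivity)]

theorem two_set {p : ℝ} (hp : 2 ≤ p) {n : ℕ} {A A' : Set (EuclideanSpace ℝ (Fin n))}
    (hA : MeasurableSet A) (hA' : MeasurableSet A') {t : ℝ} (ht : 0 ≤ t)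
    (hd : ∀ x ∈ A, ∀ x' ∈ A', t ≤ lpNormE p (x - x')) :
    volume (coneS p A) * volume (coneS p A') ≤
      (ENNReal.ofReal (exp (-((3/4) * (t/2) ^ p / p)) ^ n) *
        volume {x : EuclideanSpace ℝ (Fin n) | lpNormE p x ≤ 1}) ^ 2 := by
  rw [← ball_scale hp (exp_pos _)]
  set R := exp (-((3/4) * (t/2) ^ p / p))
  have mB : MeasurableSet {x : EuclideanSpace ℝ (Fin n) | lpNormE p x ≤ R} :=
    measurableSet_le (lpN_continuous hp).measurable measurable_const
  rw [← lintegral_indicator_one (coneS_measurable hp hA),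
    ← lintegral_indicator_one (coneS_measurable hp hA'), ← lintegral_indicator_one mB]
  refine pl_eucl n _ _ _ (measurable_one.indicator (coneS_measurable hp hA))
    (measurable_one.indicator (coneS_measurable hp hA')) (measurable_one.indicator mB) fun x y => ?_
  by_cases hx : x ∈ coneS p A
  swap
  · simp [hx]
  by_cases hy : y ∈ coneS p A'
  swap
  · simp [hy]
  have hm : (2:ℝ)⁻¹ • (x + y) ∈ {x : EuclideanSpace ℝ (Fin n) | lpNormE p x ≤ R} := by
    have := mid_bound2 hp _ _ (lpN_normalize hp hx.1) (lpN_normalize hp hy.1) _ _ hx.1.le hy.1.le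
      hx.2.1 hy.2.1 t ht (hd _ hx.2.2 _ hy.2.2)
    rwa [smul_inv_smul₀ hx.1.ne', smul_inv_smul₀ hy.1.ne'] at this
  rw [Set.indicator_of_mem hx, Set.indicator_of_mem hy, Set.indicator_of_mem hm]
  simp

end

section
open MeasureTheory Real
open scoped Pointwise
lemma z_int {p q : ℝ} (hp : 2 ≤ p) (hq : 0 ≤ q) :
    Integrable (fun x : ℝ => |x| ^ q * exp (-|x| ^ p)) ∧
    ∫ x : ℝ, |x| ^ q * exp (-|x| ^ p) = 2 * (1 / p * Gamma ((q + 1) / p)) := by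
  have e : ∫ x : ℝ, |x| ^ q * exp (-|x| ^ p) = 2 * (1 / p * Gamma ((q + 1) / p)) := by
    rw [integral_comp_abs (f := fun x => x ^ q * exp (-x ^ p)),
      integral_rpow_mul_exp_neg_rpow (by linarith) (by linarith)]
  refine ⟨?_, e⟩
  by_contra h
  rw [integral_undef h] at e
  have : 0 < Gamma ((q + 1) / p) := Gamma_pos_of_pos (by positivity)
  have : 0 < 2 * (1 / p * Gamma ((q + 1) / p)) := by positivity
  linarith

lemma lintegral_scale {n : ℕ} (F : EuclideanSpace ℝ (Fin n) → ENNReal) (hF : Measurable F)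
    {r : ℝ} (hr : 0 < r) : ∫⁻ x, F x = ENNReal.ofReal (r ^ n) * ∫⁻ x, F (r • x) := by
  have h1 : ∫⁻ x, F (r • x) = ENNReal.ofReal ((r ^ n)⁻¹) * ∫⁻ x, F x := by
    rw [← lintegral_map (μ := volume) hF (measurable_const_smul r), Measure.map_addHaar_smul _ hr.ne',
      lintegral_smul_measure, finrank_euclideanSpace_fin, abs_of_pos (by positivity)]
    rfl
  rw [h1, ← mul_assoc, ← ENNReal.ofReal_mul (by positivity), mul_inv_cancel₀ (by positivity)]
  simp

lemma exp_neg_layer {s : ℝ} (hs : 0 ≤ s) :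
    ENNReal.ofReal (exp (-s)) =
      ∫⁻ u in Set.Ioi (0:ℝ), (Set.Ici s).indicator (fun u => ENNReal.ofReal (exp (-u))) u := by
  have e : ENNReal.ofReal (exp (-s)) = ∫⁻ u in Set.Ioi s, ENNReal.ofReal (exp (-u)) := by
    rw [← integral_exp_neg_Ioi s]
    refine ofReal_integral_eq_lintegral_ofReal ?_ (.of_forall fun _ => (exp_pos _).le)
    have := exp_neg_integrableOn_Ioi s (b := 1) one_pos
    simp only [neg_mul, one_mul] at this
    exact this
  rw [lintegral_indicator measurableSet_Ici, Measure.restrict_restrict measurableSet_Ici, e]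
  refine le_antisymm ?_ ?_
  · exact lintegral_mono_set fun u hu => ⟨Set.mem_Ici.2 (le_of_lt (Set.mem_Ioi.1 hu)),
      Set.mem_Ioi.2 (lt_of_le_of_lt hs (Set.mem_Ioi.1 hu))⟩
  · rw [setLIntegral_congr Ioi_ae_eq_Ici]
    exact lintegral_mono_set fun u hu => hu.1

/-- the radial constant -/
noncomputable def radC (p : ℝ) (n : ℕ) : ENNReal :=
  ∫⁻ u in Set.Ioi (0:ℝ), ENNReal.ofReal (exp (-u) * (u ^ (1 / p)) ^ n)

lemma radC_eq {p : ℝ} (hp : 2 ≤ p) (n : ℕ) : radC p n = ENNReal.ofReal (Gamma (n / p + 1)) := by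
  have p0 : 0 < p := by linarith
  have h : 0 < (n:ℝ) / p + 1 := by positivity
  rw [Gamma_eq_integral h, ofReal_integral_eq_lintegral_ofReal]
  · refine setLIntegral_congr_fun measurableSet_Ioi fun u hu => ?_
    have hu : 0 < u := hu
    beta_reduce
    rw [← rpow_natCast, ← rpow_mul hu.le]
    congr 3
    ring
  · exact GammaIntegral_convergent h
  · filter_upwards [ae_restrict_mem measurableSet_Ioi] with u hu
    have hu : 0 < u := hu
    positivity

lemma sP_le_iff {p : ℝ} (hp : 2 ≤ p) {n : ℕ} (x : EuclideanSpace ℝ (Fin n)) {u : ℝ} (hu : 0 ≤ u) :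
    sP p x ≤ u ↔ lpNormE p x ≤ u ^ (1 / p) := by
  rw [lpN_def, rpow_le_rpow_iff (sP_nonneg p x) hu (by positivity)]

lemma layer {p : ℝ} (hp : 2 ≤ p) {n : ℕ} (ψ : EuclideanSpace ℝ (Fin n) → ENNReal)
    (hψ : Measurable ψ) (hom : ∀ r : ℝ, 0 < r → ∀ x, ψ (r • x) = ψ x) :
    ∫⁻ x, ψ x * ENNReal.ofReal (exp (-sP p x)) =
      radC p n * ∫⁻ x in {x | lpNormE p x ≤ 1}, ψ x := by
  have hsm : Measurable (sP p : EuclideanSpace ℝ (Fin n) → ℝ) := (sP_continuous hp).measurable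
  have mB : MeasurableSet {x : EuclideanSpace ℝ (Fin n) | lpNormE p x ≤ 1} :=
    measurableSet_le (lpN_continuous hp).measurable measurable_const
  have h1 : ∀ x : EuclideanSpace ℝ (Fin n), ψ x * ENNReal.ofReal (exp (-sP p x)) =
      ∫⁻ u in Set.Ioi (0:ℝ), ψ x *
        (Set.Ici (sP p x)).indicator (fun u => ENNReal.ofReal (exp (-u))) u := by
    intro x
    rw [exp_neg_layer (sP_nonneg p x), lintegral_const_mul]
    exact (by fun_prop : Measurable fun u : ℝ => ENNReal.ofReal (exp (-u))).indicator measurableSet_Ici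
  simp_rw [h1]
  rw [lintegral_lintegral_swap]
  · unfold radC
    rw [← lintegral_mul_const]
    swap
    · fun_prop
    refine setLIntegral_congr_fun measurableSet_Ioi fun u hu => ?_
    have hu : 0 < u := hu
    have hr : 0 < u ^ (1 / p) := rpow_pos_of_pos hu _
    beta_reduce
    rw [← lintegral_indicator mB]
    have h2 : ∀ x : EuclideanSpace ℝ (Fin n), ψ x *
        (Set.Ici (sP p x)).indicator (fun u => ENNReal.ofReal (exp (-u))) u =
        ENNReal.ofReal (exp (-u)) * {x : EuclideanSpace ℝ (Fin n) | lpNormE p x ≤ 1}.indicator ψ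
          ((u ^ (1 / p))⁻¹ • x) := by
      intro x
      have e : (u ^ (1 / p))⁻¹ • x ∈ {x : EuclideanSpace ℝ (Fin n) | lpNormE p x ≤ 1} ↔
          u ∈ Set.Ici (sP p x) := by
        rw [Set.mem_Ici, sP_le_iff hp x hu.le]
        change lpNormE p _ ≤ 1 ↔ _
        rw [lpN_smul hp, abs_of_pos (inv_pos.2 hr), inv_mul_le_iff₀ hr, mul_one]
      by_cases hx : u ∈ Set.Ici (sP p x)
      · rw [Set.indicator_of_mem hx, Set.indicator_of_mem (e.2 hx), hom _ (inv_pos.2 hr), mul_comm]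
      · rw [Set.indicator_of_notMem hx, Set.indicator_of_notMem (fun h => hx (e.1 h))]; simp
    simp_rw [h2]
    rw [lintegral_const_mul, lintegral_scale (r := u ^ (1 / p)) _ _ hr]
    · simp_rw [inv_smul_smul₀ hr.ne']
      rw [ENNReal.ofReal_mul (exp_pos _).le, mul_assoc]
    all_goals exact (hψ.indicator mB).comp (measurable_const_smul _)
  · refine Measurable.aemeasurable ?_
    refine (hψ.comp measurable_fst).mul ?_
    have : (fun z : EuclideanSpace ℝ (Fin n) × ℝ => (Set.Ici (sP p z.1)).indicator
        (fun u => ENNReal.ofReal (exp (-u))) z.2) =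
        ({z : EuclideanSpace ℝ (Fin n) × ℝ | sP p z.1 ≤ z.2}).indicator
          (fun z => ENNReal.ofReal (exp (-z.2))) := rfl
    change Measurable (fun z : EuclideanSpace ℝ (Fin n) × ℝ => (Set.Ici (sP p z.1)).indicator
        (fun u => ENNReal.ofReal (exp (-u))) z.2)
    rw [this]
    exact (by fun_prop : Measurable fun z : EuclideanSpace ℝ (Fin n) × ℝ =>
      ENNReal.ofReal (exp (-z.2))).indicator
      (measurableSet_le (hsm.comp measurable_fst) measurable_snd)

lemma laplace_scale {p : ℝ} (hp : 2 ≤ p) {n : ℕ} (ψ : EuclideanSpace ℝ (Fin n) → ENNReal)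
    (hψ : Measurable ψ) (hom : ∀ r : ℝ, 0 < r → ∀ x, ψ (r • x) = ψ x) {l : ℝ} (hl : 0 < l) :
    ∫⁻ x, ψ x * ENNReal.ofReal (exp (-(l * sP p x))) =
      ENNReal.ofReal (l ^ (-(n / p : ℝ))) * ∫⁻ x, ψ x * ENNReal.ofReal (exp (-sP p x)) := by
  have p0 : 0 < p := by linarith
  have hsm : Measurable (sP p : EuclideanSpace ℝ (Fin n) → ℝ) := (sP_continuous hp).measurable
  have hr : 0 < l ^ (-(1 / p)) := rpow_pos_of_pos hl _
  rw [lintegral_scale _ (by fun_prop) hr]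
  congr 1
  · rw [← rpow_natCast, ← rpow_mul hl.le]; congr 2; ring
  · refine lintegral_congr fun x => ?_
    rw [hom _ hr, sP_smul hp, abs_of_pos hr, ← rpow_mul hl.le, ← mul_assoc]
    have : -(1 / p) * p = -1 := by field_simp
    rw [this, rpow_neg_one, mul_inv_cancel₀ hl.ne', one_mul]

lemma second_moment_lower {p : ℝ} (hp : 2 ≤ p) {n : ℕ} (ψ : EuclideanSpace ℝ (Fin n) → ENNReal)
    (hψ : Measurable ψ) (hom : ∀ r : ℝ, 0 < r → ∀ x, ψ (r • x) = ψ x)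
    (hfin : ∫⁻ x, ψ x * ENNReal.ofReal (exp (-sP p x)) ≠ ⊤) :
    ENNReal.ofReal ((n / p : ℝ) ^ 2) * ∫⁻ x, ψ x * ENNReal.ofReal (exp (-sP p x)) ≤
      ∫⁻ x, ψ x * ENNReal.ofReal (sP p x ^ 2 * exp (-sP p x)) := by
  have hsm : Measurable (sP p : EuclideanSpace ℝ (Fin n) → ℝ) := (sP_continuous hp).measurable
  set J := ∫⁻ x, ψ x * ENNReal.ofReal (exp (-sP p x)) with hJ
  set T := ∫⁻ x, ψ x * ENNReal.ofReal (sP p x ^ 2 * exp (-sP p x)) with hT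
  rcases eq_or_ne T ⊤ with hTt | hTt
  · rw [hTt]; exact le_top
  set κ : ℝ := n / p with hκ
  have κ0 : 0 ≤ κ := by positivity
  have main : ∀ l : ℝ, 1 < l → (2 * κ * ((1 - l ^ (-κ)) / (l - 1)) - κ ^ 2) * J.toReal ≤ T.toReal := by
    intro l hl
    set a : ℝ := 2 * κ / (l - 1) with ha
    have a0 : 0 ≤ a := div_nonneg (by positivity) (by linarith)
    have ineq : ENNReal.ofReal a * J ≤ T + ENNReal.ofReal (κ ^ 2) * J +
        ENNReal.ofReal a * (ENNReal.ofReal (l ^ (-κ)) * J) := by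
      rw [← laplace_scale hp ψ hψ hom (by linarith : 0 < l), hJ, hT,
        ← lintegral_const_mul _ (by fun_prop), ← lintegral_const_mul _ (by fun_prop),
        ← lintegral_const_mul _ (by fun_prop), ← lintegral_add_left (by fun_prop),
        ← lintegral_add_left (by fun_prop)]
      refine lintegral_mono fun x => ?_
      have hs := sP_nonneg p x
      set s := sP p x
      have pw : a * exp (-s) ≤ s ^ 2 * exp (-s) + κ ^ 2 * exp (-s) + a * exp (-(l * s)) := by
        have e1 : exp (-(l * s)) = exp (-s) * exp (-((l - 1) * s)) := by
          rw [← exp_add]; congr 1; ring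
        have e2 := add_one_le_exp (-((l - 1) * s))
        have e3 : a * (1 - (l - 1) * s) ≤ a * exp (-((l - 1) * s)) := by
          apply mul_le_mul_of_nonneg_left _ a0; linarith
        have e4 : a * (1 - (l - 1) * s) = a - 2 * κ * s := by
          rw [ha]; field_simp [show l - 1 ≠ 0 by linarith]
        rw [e1]
        have : a ≤ s ^ 2 + κ ^ 2 + a * exp (-((l - 1) * s)) := by
          nlinarith [sq_nonneg (s - κ)]
        nlinarith [exp_pos (-s)]
      calc ENNReal.ofReal a * (ψ x * ENNReal.ofReal (exp (-s)))
          = ψ x * ENNReal.ofReal (a * exp (-s)) := by rw [ENNReal.ofReal_mul a0]; ring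
        _ ≤ ψ x * ENNReal.ofReal (s ^ 2 * exp (-s) + κ ^ 2 * exp (-s) + a * exp (-(l * s))) := by
          gcongr
        _ = _ := by
          rw [ENNReal.ofReal_add (by positivity) (by positivity),
            ENNReal.ofReal_add (by positivity) (by positivity), ENNReal.ofReal_mul a0,
            ENNReal.ofReal_mul (sq_nonneg κ)]
          ring
    have hl' : 0 ≤ l ^ (-κ) := rpow_nonneg (by linarith) _
    have r := ENNReal.toReal_mono (by finiteness) ineq
    rw [ENNReal.toReal_add (by finiteness) (by finiteness),
      ENNReal.toReal_add (by finiteness) (by finiteness)] at r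
    simp only [ENNReal.toReal_mul, ENNReal.toReal_ofReal a0, ENNReal.toReal_ofReal hl',
      ENNReal.toReal_ofReal (sq_nonneg κ)] at r
    have : 2 * κ * ((1 - l ^ (-κ)) / (l - 1)) = a * (1 - l ^ (-κ)) := by rw [ha]; ring
    rw [this]; linarith
  have lim : Filter.Tendsto (fun l : ℝ => (2 * κ * ((1 - l ^ (-κ)) / (l - 1)) - κ ^ 2) * J.toReal)
      (nhdsWithin 1 (Set.Ioi 1)) (nhds ((2 * κ * κ - κ ^ 2) * J.toReal)) := by
    refine Filter.Tendsto.mul_const _ (Filter.Tendsto.sub_const (Filter.Tendsto.const_mul _ ?_) _)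
    have hd : HasDerivAt (fun l : ℝ => l ^ (-κ)) (-κ * 1 ^ (-κ - 1)) 1 :=
      Real.hasDerivAt_rpow_const (Or.inl one_ne_zero)
    have := (hasDerivAt_iff_tendsto_slope.1 hd).mono_left
      (nhdsWithin_mono 1 (show Set.Ioi (1:ℝ) ⊆ {1}ᶜ from fun x hx => ne_of_gt hx))
    have h2 := this.neg
    simp only [one_rpow, mul_one, neg_neg] at h2
    refine h2.congr fun l => ?_
    rw [slope_def_field, one_rpow, ← neg_div, neg_sub]
  have fin : (2 * κ * κ - κ ^ 2) * J.toReal ≤ T.toReal :=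
    le_of_tendsto lim (by filter_upwards [self_mem_nhdsWithin] with l hl using main l hl)
  rw [← ENNReal.ofReal_toReal hTt, ← ENNReal.ofReal_toReal hfin, ← ENNReal.ofReal_mul (sq_nonneg κ)]
  refine ENNReal.ofReal_le_ofReal (le_trans (le_of_eq ?_) fin)
  ring

end

section
open MeasureTheory Real
open scoped Pointwise
lemma prod_lint {n : ℕ} (g : Fin n → ℝ → ℝ) (h0 : ∀ i x, 0 ≤ g i x) (hi : ∀ i, Integrable (g i))
    (hm : ∀ i, Measurable (g i)) :
    ∫⁻ x : EuclideanSpace ℝ (Fin n), ENNReal.ofReal (∏ i, g i (x i)) =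
      ENNReal.ofReal (∏ i, ∫ t, g i t) := by
  have mp := PiLp.volume_preserving_toLp (Fin n)
  have hme : Measurable fun x : EuclideanSpace ℝ (Fin n) => ENNReal.ofReal (∏ i, g i (x i)) := by
    refine ENNReal.measurable_ofReal.comp (Finset.measurable_fun_prod _ fun i _ => (hm i).comp ?_)
    fun_prop
  rw [← mp.lintegral_comp hme, ← integral_fintype_prod_volume_eq_prod,
    ofReal_integral_eq_lintegral_ofReal]
  · exact Integrable.fintype_prod_dep hi
  · exact .of_forall fun x => Finset.prod_nonneg fun i _ => h0 _ _

noncomputable def psi0 (p : ℝ) {n : ℕ} (x : EuclideanSpace ℝ (Fin n)) : ENNReal :=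
  ENNReal.ofReal ((∑ i, (|x i| ^ p) ^ 2) / sP p x ^ 2)

noncomputable def Zg (p q : ℝ) : ℝ := 2 * (1 / p * Gamma ((q + 1) / p))

lemma Zg_two {p : ℝ} (hp : 2 ≤ p) : Zg p (2 * p) = Zg p 0 * ((p + 1) / p ^ 2) := by
  have p0 : 0 < p := by linarith
  have e : (2 * p + 1) / p = (0 + 1) / p + 1 + 1 := by field_simp; ring
  unfold Zg
  rw [e, Gamma_add_one (by positivity), Gamma_add_one (by positivity)]
  field_simp
  ring

lemma exp_sP (p : ℝ) {n : ℕ} (x : EuclideanSpace ℝ (Fin n)) :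
    exp (-sP p x) = ∏ i, exp (-|x i| ^ p) := by
  rw [← exp_sum, Finset.sum_neg_distrib]; rfl

lemma lint_exp {p : ℝ} (hp : 2 ≤ p) (n : ℕ) :
    ∫⁻ x : EuclideanSpace ℝ (Fin n), ENNReal.ofReal (exp (-sP p x)) = ENNReal.ofReal (Zg p 0 ^ n) := by
  simp_rw [exp_sP]
  have z := z_int hp le_rfl
  simp only [rpow_zero, one_mul] at z
  rw [prod_lint (fun _ t => exp (-|t| ^ p)) (fun _ _ => (exp_pos _).le) (fun _ => z.1)
    (fun _ => by fun_prop)]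
  rw [z.2]; simp [Zg]

lemma lint_exp2 {p : ℝ} (hp : 2 ≤ p) (n : ℕ) (i : Fin n) :
    ∫⁻ x : EuclideanSpace ℝ (Fin n), ENNReal.ofReal ((|x i| ^ p) ^ 2 * exp (-sP p x)) =
      ENNReal.ofReal ((p + 1) / p ^ 2 * Zg p 0 ^ n) := by
  have p0 : 0 < p := by linarith
  have q0 : ∀ j : Fin n, (0:ℝ) ≤ if j = i then 2 * p else 0 := fun j => by split_ifs <;> positivity
  have h := prod_lint (fun (j : Fin n) t => |t| ^ (if j = i then 2 * p else 0) * exp (-|t| ^ p))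
    (fun _ _ => by positivity) (fun j => (z_int hp (q0 j)).1) (fun j => by fun_prop)
  simp_rw [fun j => (z_int hp (q0 j)).2] at h
  have e1 : ∏ j : Fin n, (2 * (1 / p * Gamma (((if j = i then 2 * p else 0) + 1) / p))) =
      (p + 1) / p ^ 2 * Zg p 0 ^ n := by
    have : ∀ j : Fin n, (2 * (1 / p * Gamma (((if j = i then 2 * p else 0) + 1) / p))) =
        Zg p 0 * (if j = i then (p + 1) / p ^ 2 else 1) := by
      intro j
      split_ifs
      · exact Zg_two hp
      · rw [mul_one]; rfl
    simp_rw [this]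
    rw [Finset.prod_mul_distrib]
    simp [mul_comm]
  rw [← e1, ← h]
  refine lintegral_congr fun x => ?_
  rw [Finset.prod_mul_distrib, exp_sP]
  congr 2
  rw [Finset.prod_eq_single i]
  · simp only [if_true]
    rw [mul_comm 2 p, rpow_mul (abs_nonneg _)]; norm_num
  · intro j _ hj; simp [hj]
  · simp

lemma moment_lemma {p : ℝ} (hp : 2 ≤ p) {n : ℕ} (hn : 0 < n) :
    ∫⁻ x in {x : EuclideanSpace ℝ (Fin n) | lpNormE p x ≤ 1}, psi0 p x ≤
      ENNReal.ofReal ((p + 1) / n) * volume {x : EuclideanSpace ℝ (Fin n) | lpNormE p x ≤ 1} := by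
  have p0 : 0 < p := by linarith
  have n0 : (0:ℝ) < n := by exact_mod_cast hn
  have hsm : Measurable (sP p : EuclideanSpace ℝ (Fin n) → ℝ) := (sP_continuous hp).measurable
  have hψ : Measurable (psi0 p : EuclideanSpace ℝ (Fin n) → ENNReal) := by
    unfold psi0; fun_prop
  have hom : ∀ r : ℝ, 0 < r → ∀ x : EuclideanSpace ℝ (Fin n), psi0 p (r • x) = psi0 p x := by
    intro r hr x
    unfold psi0
    congr 1
    have hrp : 0 < r ^ p := rpow_pos_of_pos hr _
    have : ∀ i, (|(r • x) i| ^ p) ^ 2 = (r ^ p) ^ 2 * (|x i| ^ p) ^ 2 := by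
      intro i
      rw [PiLp.smul_apply, smul_eq_mul, abs_mul, mul_rpow (abs_nonneg _) (abs_nonneg _),
        abs_of_pos hr, mul_pow]
    simp_rw [this]
    rw [← Finset.mul_sum, sP_smul hp, abs_of_pos hr, mul_pow, mul_div_mul_left _ _ (by positivity)]
  have le1 : ∀ x : EuclideanSpace ℝ (Fin n), psi0 p x ≤ 1 := by
    intro x
    unfold psi0
    rw [← ENNReal.ofReal_one]
    refine ENNReal.ofReal_le_ofReal (div_le_one_of_le₀ ?_ (sq_nonneg _))
    exact Finset.sum_sq_le_sq_sum_of_nonneg fun i _ => by positivity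
  have hl := lint_exp hp n
  set J := ∫⁻ x : EuclideanSpace ℝ (Fin n), psi0 p x * ENNReal.ofReal (exp (-sP p x)) with hJ
  have hfin : J ≠ ⊤ := by
    refine ne_top_of_le_ne_top (b := ENNReal.ofReal (Zg p 0 ^ n)) ENNReal.ofReal_ne_top ?_
    rw [← hl]
    refine lintegral_mono fun x => ?_
    calc _ ≤ 1 * ENNReal.ofReal (exp (-sP p x)) := by gcongr; exact le1 x
      _ = _ := one_mul _
  have h2 := second_moment_lower hp (psi0 p) hψ hom hfin
  have h3 : ∫⁻ x : EuclideanSpace ℝ (Fin n), psi0 p x * ENNReal.ofReal (sP p x ^ 2 * exp (-sP p x)) =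
      n * ENNReal.ofReal ((p + 1) / p ^ 2 * Zg p 0 ^ n) := by
    have : ∀ x : EuclideanSpace ℝ (Fin n), psi0 p x * ENNReal.ofReal (sP p x ^ 2 * exp (-sP p x)) =
        ∑ i, ENNReal.ofReal ((|x i| ^ p) ^ 2 * exp (-sP p x)) := by
      intro x
      unfold psi0
      rw [← ENNReal.ofReal_mul (div_nonneg (Finset.sum_nonneg fun i _ => by positivity) (sq_nonneg _)),
        ← ENNReal.ofReal_sum_of_nonneg (fun i _ => by positivity), ← Finset.sum_mul, ← mul_assoc]
      congr 2
      by_cases hs : sP p x = 0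
      · have : ∀ i, |x i| ^ p = 0 := fun i =>
          (Finset.sum_eq_zero_iff_of_nonneg (fun i _ => by positivity)).1 hs i (Finset.mem_univ i)
        simp [this]
      · field_simp
    simp_rw [this]
    rw [lintegral_finsetSum _ (fun i _ => by fun_prop)]
    simp_rw [lint_exp2 hp n]
    simp
  rw [← hJ, h3] at h2
  have hL := layer hp (psi0 p) hψ hom
  have h1 := layer hp (fun _ : EuclideanSpace ℝ (Fin n) => 1) measurable_const (fun _ _ _ => rfl)
  simp only [one_mul, setLIntegral_one] at h1
  rw [hl] at h1
  rw [← hJ] at hL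
  set V := volume {x : EuclideanSpace ℝ (Fin n) | lpNormE p x ≤ 1}
  set I := ∫⁻ x in {x : EuclideanSpace ℝ (Fin n) | lpNormE p x ≤ 1}, psi0 p x
  rw [hL, ENNReal.ofReal_mul (by positivity), h1] at h2
  have r0 : radC p n ≠ 0 := by
    rw [radC_eq hp]; simp only [ne_eq, ENNReal.ofReal_eq_zero, not_le]; exact Gamma_pos_of_pos (by positivity)
  have rt : radC p n ≠ ⊤ := by rw [radC_eq hp]; exact ENNReal.ofReal_ne_top
  have h4 : radC p n * (ENNReal.ofReal ((n / p) ^ 2) * I) ≤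
      radC p n * (ENNReal.ofReal ((n / p) ^ 2) * (ENNReal.ofReal ((p + 1) / n) * V)) := by
    calc _ = ENNReal.ofReal ((n / p) ^ 2) * (radC p n * I) := by ring
      _ ≤ _ := h2
      _ = (ENNReal.ofReal n * ENNReal.ofReal ((p + 1) / p ^ 2)) * (radC p n * V) := by
          rw [ENNReal.ofReal_natCast]; ring
      _ = ENNReal.ofReal ((n / p) ^ 2) * ENNReal.ofReal ((p + 1) / n) * (radC p n * V) := by
          rw [← ENNReal.ofReal_mul (by positivity), ← ENNReal.ofReal_mul (by positivity)]
          congr 2; field_simp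
      _ = _ := by ring
  rw [ENNReal.mul_le_mul_iff_right r0 rt, ENNReal.mul_le_mul_iff_right ?_ ENNReal.ofReal_ne_top] at h4
  · exact h4
  · simp only [ne_eq, ENNReal.ofReal_eq_zero, not_le]; positivity

end

section
open MeasureTheory Real
open scoped Pointwise
lemma haus_const (d : ℕ) : ∃ K : ENNReal, K ≠ 0 ∧ K ≠ ⊤ ∧
    (μH[(d:ℝ)] : Measure (EuclideanSpace ℝ (Fin d))) = K • volume := by
  have hfr : ((Module.finrank ℝ (EuclideanSpace ℝ (Fin d)) : ℕ) : ℝ) = d := by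
    rw [finrank_euclideanSpace_fin]
  have : (μH[(d:ℝ)] : Measure (EuclideanSpace ℝ (Fin d))).IsAddHaarMeasure := by
    rw [← hfr]; infer_instance
  refine ⟨Measure.addHaarScalarFactor μH[(d:ℝ)] (volume : Measure (EuclideanSpace ℝ (Fin d))), ?_, by simp, ?_⟩
  · simp only [ne_eq, ENNReal.coe_eq_zero]
    exact (Measure.addHaarScalarFactor_pos_of_isAddHaarMeasure _ _).ne'
  · exact Measure.isAddLeftInvariant_eq_smul _ _

/-- cone over a subset of the hyperplane `x 0 = s`. -/
def coneH {d : ℕ} (N : EuclideanSpace ℝ (Fin (d + 1))) (s : ℝ)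
    (Q : Set (EuclideanSpace ℝ (Fin (d + 1)))) : Set (EuclideanSpace ℝ (Fin (d + 1))) :=
  {y | (0 < inner ℝ N y ∧ inner ℝ N y ≤ s) ∧ (s / inner ℝ N y) • y ∈ Q}

lemma exists_frame {d : ℕ} (N : EuclideanSpace ℝ (Fin (d + 1))) (hN : ‖N‖ = 1) :
    ∃ Φ : EuclideanSpace ℝ (Fin (d + 1)) ≃ₗᵢ[ℝ] EuclideanSpace ℝ (Fin (d + 1)),
      ∀ x, (Φ x) 0 = inner ℝ N x := by
  have ho : Orthonormal ℝ (({(0 : Fin (d+1))} : Set (Fin (d+1))).domRestrict fun _ => N) := by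
    constructor
    · intro i; simpa using hN
    · intro i j hij; exact absurd (Subsingleton.elim i j) hij
  obtain ⟨b, hb⟩ := ho.exists_orthonormalBasis_extension_of_card_eq (by simp)
  refine ⟨b.repr, fun x => ?_⟩
  rw [b.repr_apply_apply, hb 0 rfl]

lemma cone_e0 {d : ℕ} {s : ℝ} (hs : 0 < s) (Q : Set (EuclideanSpace ℝ (Fin (d + 1))))
    (hQ : MeasurableSet Q) :
    volume {y : EuclideanSpace ℝ (Fin (d+1)) | (0 < y 0 ∧ y 0 ≤ s) ∧ (s / y 0) • y ∈ Q} =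
      ENNReal.ofReal (s / (d + 1)) *
        volume {z : EuclideanSpace ℝ (Fin d) | WithLp.toLp 2 (Fin.cons s z.ofLp : Fin (d+1) → ℝ) ∈ Q} := by
  set Q1 : Set (Fin d → ℝ) := {z | WithLp.toLp 2 (Fin.cons s z : Fin (d+1) → ℝ) ∈ Q} with hQ1
  have mc : Measurable fun z : Fin d → ℝ => (Fin.cons s z : Fin (d+1) → ℝ) := by
    refine measurable_pi_lambda _ fun i => ?_
    refine Fin.cases ?_ (fun j => ?_) i
    · simp
    · simp only [Fin.cons_succ]; fun_prop
  have mQ1 : MeasurableSet Q1 := by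
    have : Measurable fun z : Fin d → ℝ => WithLp.toLp 2 (Fin.cons s z : Fin (d+1) → ℝ) :=
      (PiLp.volume_preserving_toLp (Fin (d+1))).measurable.comp mc
    exact this hQ
  have e1 : volume {z : EuclideanSpace ℝ (Fin d) | WithLp.toLp 2 (Fin.cons s z.ofLp : Fin (d+1) → ℝ) ∈ Q}
      = volume Q1 := 
    (PiLp.volume_preserving_ofLp (Fin d)).measure_preimage mQ1.nullMeasurableSet
  rw [e1]
  set C := {y : EuclideanSpace ℝ (Fin (d+1)) | (0 < y 0 ∧ y 0 ≤ s) ∧ (s / y 0) • y ∈ Q} with hC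
  have mC : MeasurableSet C := by
    have m0 : Measurable fun y : EuclideanSpace ℝ (Fin (d+1)) => y 0 := by fun_prop
    refine MeasurableSet.inter ((measurableSet_lt measurable_const m0).inter
      (measurableSet_le m0 measurable_const)) ?_
    exact (by fun_prop : Measurable fun y : EuclideanSpace ℝ (Fin (d+1)) => (s / y 0) • y) hQ
  have mp2 := (volume_preserving_piFinSuccAbove (fun _ : Fin (d+1) => ℝ) 0).symm
  have mp := (PiLp.volume_preserving_toLp (Fin (d+1))).comp mp2
  rw [← mp.measure_preimage mC.nullMeasurableSet, Measure.volume_eq_prod,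
    Measure.prod_apply (mp.measurable mC)]
  have e2 : ∀ u : ℝ, volume (Prod.mk u ⁻¹' ((WithLp.toLp 2 ∘
      (MeasurableEquiv.piFinSuccAbove (fun _ : Fin (d+1) => ℝ) 0).symm) ⁻¹' C)) =
      (Set.Ioc 0 s).indicator (fun u => ENNReal.ofReal ((u / s) ^ d) * volume Q1) u := by
    intro u
    by_cases hu : u ∈ Set.Ioc 0 s
    · rw [Set.indicator_of_mem hu]
      have u0 : 0 < u := hu.1
      have us : 0 < u / s := div_pos u0 hs
      have : (Prod.mk u ⁻¹' ((WithLp.toLp 2 ∘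
          (MeasurableEquiv.piFinSuccAbove (fun _ : Fin (d+1) => ℝ) 0).symm) ⁻¹' C)) = (u / s) • Q1 := by
        ext w
        rw [Set.mem_smul_set_iff_inv_smul_mem₀ us.ne']
        have hh : (s / u) • (WithLp.toLp 2 (Fin.cons u w : Fin (d+1) → ℝ)) =
            WithLp.toLp 2 (Fin.cons s ((u/s)⁻¹ • w) : Fin (d+1) → ℝ) := by
          ext i
          refine Fin.cases ?_ (fun j => ?_) i
          · simp; field_simp
          · simp
        rw [hQ1]
        change _ ↔ WithLp.toLp 2 (Fin.cons s ((u/s)⁻¹ • w) : Fin (d+1) → ℝ) ∈ Q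
        rw [← hh]
        change (((0 < u ∧ u ≤ s) ∧ (s / u) • WithLp.toLp 2 ((0 : Fin (d+1)).insertNth u w : Fin (d+1) → ℝ) ∈ Q)) ↔ _
        rw [Fin.insertNth_zero]
        exact and_iff_right ⟨hu.1, hu.2⟩
      rw [this, Measure.addHaar_smul, abs_of_pos (by positivity)]
      simp
    · rw [Set.indicator_of_notMem hu]
      have : (Prod.mk u ⁻¹' ((WithLp.toLp 2 ∘
          (MeasurableEquiv.piFinSuccAbove (fun _ : Fin (d+1) => ℝ) 0).symm) ⁻¹' C)) = ∅ := by
        ext w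
        simp only [Set.mem_empty_iff_false, iff_false]
        intro h
        exact hu ⟨h.1.1, h.1.2⟩
      rw [this, measure_empty]
  simp_rw [e2]
  rw [lintegral_indicator measurableSet_Ioc, lintegral_mul_const _ (by fun_prop)]
  congr 1
  rw [← ofReal_integral_eq_lintegral_ofReal]
  · congr 1
    rw [← intervalIntegral.integral_of_le hs.le]
    simp_rw [div_pow]
    rw [intervalIntegral.integral_div, integral_pow]
    field_simp
    simp
    ring
  · exact (by fun_prop : Continuous fun u : ℝ => (u / s) ^ d).integrableOn_Ioc
  · filter_upwards [ae_restrict_mem measurableSet_Ioc] with u hu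
    have := hu.1
    positivity

lemma hyper (d : ℕ) : ∃ K : ENNReal, K ≠ 0 ∧ K ≠ ⊤ ∧
    ∀ N : EuclideanSpace ℝ (Fin (d + 1)), ‖N‖ = 1 → ∀ s : ℝ, 0 < s →
    ∀ Q : Set (EuclideanSpace ℝ (Fin (d + 1))), MeasurableSet Q → (∀ x ∈ Q, inner ℝ N x = s) →
      ENNReal.ofReal s * μH[(d:ℝ)] Q = K * volume (coneH N s Q) := by
  obtain ⟨K, K0, Kt, hK⟩ := haus_const d
  refine ⟨K * (d + 1), by simp [K0], by finiteness, ?_⟩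
  intro N hN s hs Q hQ hQs
  obtain ⟨Φ, hΦ⟩ := exists_frame N hN
  set Q2 := Φ.symm ⁻¹' Q with hQ2
  have mQ2 : MeasurableSet Q2 := Φ.symm.continuous.measurable hQ
  have e1 : coneH N s Q = Φ ⁻¹' {y : EuclideanSpace ℝ (Fin (d+1)) |
      (0 < y 0 ∧ y 0 ≤ s) ∧ (s / y 0) • y ∈ Q2} := by
    ext y
    simp only [coneH, Set.mem_ofPred_eq, Set.mem_preimage, hΦ, hQ2, map_smul,
      LinearIsometryEquiv.symm_apply_apply]
  have mC : MeasurableSet {y : EuclideanSpace ℝ (Fin (d+1)) |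
      (0 < y 0 ∧ y 0 ≤ s) ∧ (s / y 0) • y ∈ Q2} := by
    have m0 : Measurable fun y : EuclideanSpace ℝ (Fin (d+1)) => y 0 := by fun_prop
    refine MeasurableSet.inter ((measurableSet_lt measurable_const m0).inter
      (measurableSet_le m0 measurable_const)) ?_
    exact (by fun_prop : Measurable fun y : EuclideanSpace ℝ (Fin (d+1)) => (s / y 0) • y) mQ2
  rw [e1, (Φ.measurePreserving).measure_preimage mC.nullMeasurableSet, cone_e0 hs Q2 mQ2]
  set Q3 := {z : EuclideanSpace ℝ (Fin d) | WithLp.toLp 2 (Fin.cons s z.ofLp : Fin (d+1) → ℝ) ∈ Q2}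
  have iso : Isometry (fun z : EuclideanSpace ℝ (Fin d) =>
      Φ.symm (WithLp.toLp 2 (Fin.cons s z.ofLp : Fin (d+1) → ℝ))) := by
    refine Φ.symm.isometry.comp ?_
    refine Isometry.of_dist_eq fun x y => ?_
    rw [EuclideanSpace.dist_eq, EuclideanSpace.dist_eq, Fin.sum_univ_succ]
    simp
  have img : (fun z : EuclideanSpace ℝ (Fin d) =>
      Φ.symm (WithLp.toLp 2 (Fin.cons s z.ofLp : Fin (d+1) → ℝ))) '' Q3 = Q := by
    ext x
    constructor
    · rintro ⟨z, hz, rfl⟩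
      exact hz
    · intro hx
      have key : (WithLp.toLp 2 (Fin.cons s (fun j : Fin d => (Φ x) j.succ) : Fin (d+1) → ℝ)) = Φ x := by
        ext i
        refine Fin.cases ?_ (fun j => ?_) i
        · simp [hΦ, hQs x hx]
        · simp
      refine ⟨WithLp.toLp 2 (fun j : Fin d => (Φ x) j.succ), ?_, ?_⟩
      · change Φ.symm (WithLp.toLp 2 (Fin.cons s (fun j : Fin d => (Φ x) j.succ) : Fin (d+1) → ℝ)) ∈ Q
        rw [key]; simpa using hx
      · change Φ.symm (WithLp.toLp 2 (Fin.cons s (fun j : Fin d => (Φ x) j.succ) : Fin (d+1) → ℝ)) = x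
        rw [key]; simp
  have e3 : μH[(d:ℝ)] Q = μH[(d:ℝ)] Q3 := by
    conv_lhs => rw [← img]
    exact iso.hausdorffMeasure_image (Or.inl (by positivity)) _
  rw [e3, hK, Measure.smul_apply, smul_eq_mul]
  have : (ENNReal.ofReal s) = ((d:ENNReal) + 1) * ENNReal.ofReal (s / (d + 1)) := by
    have : ((d:ENNReal) + 1) = ENNReal.ofReal (d + 1) := by
      rw [ENNReal.ofReal_add (by positivity) (by positivity)]; simp
    rw [this, ← ENNReal.ofReal_mul (by positivity)]
    congr 1; field_simp
  rw [this]; ring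

end

section
open MeasureTheory Real
open scoped Pointwise
/-- (gradient of `sP`) / p -/
noncomputable def gP (p : ℝ) {n : ℕ} (x : EuclideanSpace ℝ (Fin n)) : EuclideanSpace ℝ (Fin n) :=
  WithLp.toLp 2 fun i => |x i| ^ (p - 2) * x i

lemma gP_continuous {p : ℝ} (hp : 2 ≤ p) {n : ℕ} :
    Continuous (gP p : EuclideanSpace ℝ (Fin n) → EuclideanSpace ℝ (Fin n)) := by
  unfold gP
  refine (PiLp.continuous_toLp 2 _).comp (continuous_pi fun i => ?_)
  have h : Continuous fun x : EuclideanSpace ℝ (Fin n) => x i := by fun_prop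
  exact (h.abs.rpow_const fun x => Or.inr (by linarith)).mul h

lemma inner_gP {p : ℝ} {n : ℕ} (x v : EuclideanSpace ℝ (Fin n)) :
    inner ℝ (gP p x) v = ∑ i, |x i| ^ (p - 2) * x i * v i := by
  rw [PiLp.inner_apply]
  refine Finset.sum_congr rfl fun i _ => ?_
  simp [gP, mul_comm]

lemma abs_rpow_sub_two {p : ℝ} (hp : 2 ≤ p) (a : ℝ) : |a| ^ (p - 2) * a * a = |a| ^ p := by
  rcases eq_or_ne a 0 with rfl | ha
  · simp [zero_rpow (by linarith : p ≠ 0)]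
  · rw [mul_assoc, ← abs_mul_abs_self a, ← sq, ← rpow_two, ← rpow_add (abs_pos.2 ha)]
    congr 1; ring

lemma inner_gP_self {p : ℝ} (hp : 2 ≤ p) {n : ℕ} (x : EuclideanSpace ℝ (Fin n)) :
    inner ℝ (gP p x) x = sP p x := by
  rw [inner_gP]
  exact Finset.sum_congr rfl fun i _ => abs_rpow_sub_two hp _

lemma sP_strict {p : ℝ} (hp : 2 ≤ p) {n : ℕ} (x : EuclideanSpace ℝ (Fin n)) :
    HasStrictFDerivAt (sP p) (p • innerSL ℝ (gP p x)) x := by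
  have h1 : ∀ i ∈ (Finset.univ : Finset (Fin n)), HasStrictFDerivAt
      (fun y : EuclideanSpace ℝ (Fin n) => |y i| ^ p)
      ((p * |x i| ^ (p - 2) * x i) • (EuclideanSpace.proj i : EuclideanSpace ℝ (Fin n) →L[ℝ] ℝ)) x := by
    intro i _
    have hc : ContDiffAt ℝ 1 (fun t : ℝ => |t| ^ p) (x i) :=
      (contDiff_norm_rpow (E := ℝ) (by linarith : 1 < p)).contDiffAt
    have hd := hc.hasStrictDerivAt one_ne_zero
    rw [(hasDerivAt_abs_rpow (x i) (by linarith : 1 < p)).deriv] at hd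
    exact hd.comp_hasStrictFDerivAt x
      (EuclideanSpace.proj i : EuclideanSpace ℝ (Fin n) →L[ℝ] ℝ).hasStrictFDerivAt
  have h2 := HasStrictFDerivAt.fun_sum h1
  have e : p • innerSL ℝ (gP p x) = ∑ i, (p * |x i| ^ (p - 2) * x i) •
      (EuclideanSpace.proj i : EuclideanSpace ℝ (Fin n) →L[ℝ] ℝ) := by
    ext v
    simp [innerSL_apply_apply, inner_gP, Finset.mul_sum, mul_assoc]
  rw [e]
  exact h2

lemma sP_eq_one {p : ℝ} (hp : 2 ≤ p) {n : ℕ} {x : EuclideanSpace ℝ (Fin n)} (hx : lpNormE p x = 1) :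
    sP p x = 1 := by
  rw [← lpN_rpow hp, hx, one_rpow]

lemma local_geom {p : ℝ} (hp : 2 ≤ p) {n : ℕ} {x0 : EuclideanSpace ℝ (Fin n)}
    (hx0 : lpNormE p x0 = 1) {r : ℝ} (hr : 1 < r) :
    ∃ N : EuclideanSpace ℝ (Fin n), ∃ s : ℝ, ‖N‖ = 1 ∧ 0 < s ∧ s * ‖gP p x0‖ = 1 ∧
    ∃ U ∈ nhds x0, (∀ x ∈ U, 0 < inner ℝ N x ∧ s / inner ℝ N x ≤ r ∧ inner ℝ N x / s ≤ r ∧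
      ‖gP p x‖ ≤ r * ‖gP p x0‖ ∧ ‖gP p x0‖ ≤ r * ‖gP p x‖) ∧
    ∀ x ∈ U, ∀ y ∈ U, lpNormE p x = 1 → lpNormE p y = 1 →
      dist ((s / inner ℝ N x) • x) ((s / inner ℝ N y) • y) ≤ r * dist x y ∧
      dist x y ≤ r * dist ((s / inner ℝ N x) • x) ((s / inner ℝ N y) • y) := by
  have p0 : 0 < p := by linarith
  have h0 : 0 < ‖gP p x0‖ := by
    rw [norm_pos_iff]
    intro h
    have := inner_gP_self hp x0
    rw [h, inner_zero_left, sP_eq_one hp hx0] at this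
    norm_num at this
  set H := ‖gP p x0‖ with hH
  set N : EuclideanSpace ℝ (Fin n) := H⁻¹ • gP p x0 with hNdef
  set s : ℝ := H⁻¹ with hs
  have s0 : 0 < s := inv_pos.2 h0
  have hN0 : inner ℝ N x0 = s := by
    rw [hNdef, real_inner_smul_left, inner_gP_self hp, sP_eq_one hp hx0, mul_one]
  have cN : Continuous fun x : EuclideanSpace ℝ (Fin n) => inner ℝ N x := by fun_prop
  have r0 : 0 < r := by linarith
  set δ : ℝ := 1 - r⁻¹ with hδ
  have rinv : r⁻¹ < 1 := inv_lt_one_of_one_lt₀ hr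
  have δ0 : 0 < δ := by rw [hδ]; linarith
  set C : ℝ := ‖x0‖ / s + 1 with hC
  have C0 : 0 < C := by positivity
  set ε : ℝ := δ / (2 * C) with hε
  have ε0 : 0 < ε := by positivity
  -- pointwise
  have ev1 : ∀ᶠ x in nhds x0, 0 < inner ℝ N x ∧ s / inner ℝ N x ≤ r ∧ inner ℝ N x / s ≤ r ∧
      ‖gP p x‖ ≤ r * H ∧ H ≤ r * ‖gP p x‖ := by
    have t1 : Filter.Tendsto (fun x : EuclideanSpace ℝ (Fin n) => inner ℝ N x) (nhds x0) (nhds s) := by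
      have := cN.tendsto x0; rwa [hN0] at this
    have t2 : Filter.Tendsto (fun x : EuclideanSpace ℝ (Fin n) => s / inner ℝ N x) (nhds x0) (nhds 1) := by
      have := (tendsto_const_nhds (x := s)).div t1 s0.ne'
      rwa [div_self s0.ne'] at this
    have t3 : Filter.Tendsto (fun x : EuclideanSpace ℝ (Fin n) => inner ℝ N x / s) (nhds x0) (nhds 1) := by
      have := t1.div_const s
      rwa [div_self s0.ne'] at this
    have t4 : Filter.Tendsto (fun x : EuclideanSpace ℝ (Fin n) => ‖gP p x‖) (nhds x0) (nhds H) :=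
      (gP_continuous hp).norm.tendsto x0
    have t5 := t4.const_mul r
    filter_upwards [t1.eventually (lt_mem_nhds s0), t2.eventually (gt_mem_nhds hr),
      t3.eventually (gt_mem_nhds hr), t4.eventually (gt_mem_nhds (show H < r * H by nlinarith)),
      t5.eventually (lt_mem_nhds (show H < r * H by nlinarith))] with x a1 a2 a3 a4 a5
    exact ⟨a1, a2.le, a3.le, a4.le, a5.le⟩
  have ev2 : ∀ᶠ z : EuclideanSpace ℝ (Fin n) × EuclideanSpace ℝ (Fin n) in nhds (x0, x0),
      |s / inner ℝ N z.1 - 1| ≤ δ / 2 ∧ s * ‖z.2‖ / (inner ℝ N z.1 * inner ℝ N z.2) ≤ C ∧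
      (lpNormE p z.1 = 1 → lpNormE p z.2 = 1 → |inner ℝ N (z.1 - z.2)| ≤ ε * ‖z.1 - z.2‖) := by
    have c1 : Continuous fun z : EuclideanSpace ℝ (Fin n) × EuclideanSpace ℝ (Fin n) =>
        inner ℝ N z.1 := cN.comp continuous_fst
    have c2 : Continuous fun z : EuclideanSpace ℝ (Fin n) × EuclideanSpace ℝ (Fin n) =>
        inner ℝ N z.2 := cN.comp continuous_snd
    have t1 := c1.tendsto (x0, x0)
    have t2 := c2.tendsto (x0, x0)
    simp only [hN0] at t1 t2
    have u1 := (((tendsto_const_nhds (x := s)).div t1 s0.ne').sub_const 1).abs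
    rw [div_self s0.ne', sub_self, abs_zero] at u1
    have u2 := ((((continuous_snd.norm).tendsto ((x0, x0) : EuclideanSpace ℝ (Fin n) ×
      EuclideanSpace ℝ (Fin n))).const_mul s).div (t1.mul t2) (mul_pos s0 s0).ne')
    have lt : s * ‖((x0, x0) : EuclideanSpace ℝ (Fin n) × EuclideanSpace ℝ (Fin n)).2‖ / (s * s) < C := by
      have : s * ‖x0‖ / (s * s) = ‖x0‖ / s := by field_simp
      change s * ‖x0‖ / (s * s) < C
      rw [this]; linarith
    have o := (sP_strict hp x0).isLittleO.def (c := ε * (p * H)) (by positivity)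
    filter_upwards [u1.eventually (gt_mem_nhds (half_pos δ0)), u2.eventually (gt_mem_nhds lt), o]
      with z a1 a2 a3
    refine ⟨a1.le, a2.le, fun hz1 hz2 => ?_⟩
    rw [sP_eq_one hp hz1, sP_eq_one hp hz2, sub_self, zero_sub, norm_neg] at a3
    have e : (p • innerSL ℝ (gP p x0)) (z.1 - z.2) = (p * H) * inner ℝ N (z.1 - z.2) := by
      rw [smul_apply, innerSL_apply_apply, smul_eq_mul, hNdef,
        real_inner_smul_left, hs]
      field_simp
    rw [e, norm_mul, Real.norm_eq_abs, Real.norm_eq_abs, abs_of_pos (by positivity : 0 < p * H)] at a3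
    have := mul_pos p0 h0
    nlinarith
  rw [nhds_prod_eq, Filter.eventually_prod_self_iff'] at ev2
  obtain ⟨U2, hU2, h2⟩ := ev2
  refine ⟨N, s, ?_, s0, inv_mul_cancel₀ h0.ne', _, Filter.inter_mem ev1 hU2, fun x hx => hx.1, ?_⟩
  · rw [hNdef, norm_smul, norm_inv, norm_norm, inv_mul_cancel₀ h0.ne']
  intro x hx y hy hxS hyS
  obtain ⟨b1, b2, b3⟩ := h2 x hx.2 y hy.2
  have b3 := b3 hxS hyS
  simp only at b1 b2 b3
  have ax := hx.1.1
  have ay := hy.1.1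
  set a := inner ℝ N x with ha
  set b := inner ℝ N y with hb
  have dec : (s / a) • x - (s / b) • y - (x - y) =
      (s / a - 1) • (x - y) + (s / (a * b) * (b - a)) • y := by
    have : s / (a * b) * (b - a) = s / a - s / b := by field_simp
    rw [this]; module
  have nb : ‖(s / a) • x - (s / b) • y - (x - y)‖ ≤ δ * ‖x - y‖ := by
    rw [dec]
    refine (norm_add_le _ _).trans ?_
    rw [norm_smul, norm_smul, Real.norm_eq_abs, Real.norm_eq_abs, abs_mul,
      abs_of_pos (by positivity : 0 < s / (a * b))]
    rw [inner_sub_right, ← ha, ← hb, abs_sub_comm] at b3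
    have k1 : |s / a - 1| * ‖x - y‖ ≤ δ / 2 * ‖x - y‖ := by gcongr
    have k2 : s / (a * b) * |b - a| * ‖y‖ ≤ δ / 2 * ‖x - y‖ := by
      calc s / (a * b) * |b - a| * ‖y‖ = (s * ‖y‖ / (a * b)) * |b - a| := by ring
        _ ≤ C * (ε * ‖x - y‖) := by gcongr
        _ = δ / 2 * ‖x - y‖ := by rw [hε]; field_simp
    linarith
  rw [dist_eq_norm, dist_eq_norm]
  have n1 := norm_sub_norm_le ((s / a) • x - (s / b) • y) (x - y)
  have n2 := norm_sub_norm_le (x - y) ((s / a) • x - (s / b) • y)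
  rw [norm_sub_rev (x - y)] at n2
  have nn := norm_nonneg (x - y)
  have rr : r * r⁻¹ = 1 := mul_inv_cancel₀ r0.ne'
  constructor
  · have : 1 + δ ≤ r := by
      rw [hδ]; nlinarith [sq_nonneg (r - 1), inv_pos.2 r0]
    nlinarith
  · have : r⁻¹ * ‖x - y‖ ≤ ‖(s / a) • x - (s / b) • y‖ := by
      have : r⁻¹ = 1 - δ := by rw [hδ]; ring
      rw [this]; linarith
    calc ‖x - y‖ = r * (r⁻¹ * ‖x - y‖) := by rw [← mul_assoc, rr, one_mul]
      _ ≤ _ := by gcongr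

end

section
open MeasureTheory Real
open scoped Pointwise
/-- unnormalised cone measure -/
noncomputable def mS (p : ℝ) (n : ℕ) : Measure (EuclideanSpace ℝ (Fin n)) :=
  (volume.restrict {x | 0 < lpNormE p x ∧ lpNormE p x ≤ 1}).map (fun x => (lpNormE p x)⁻¹ • x)

lemma mS_apply {p : ℝ} (hp : 2 ≤ p) {n : ℕ} {A : Set (EuclideanSpace ℝ (Fin n))}
    (hA : MeasurableSet A) : mS p n A = volume (coneS p A) := by
  unfold mS
  rw [Measure.map_apply (normalize_measurable hp) hA,
    Measure.restrict_apply (normalize_measurable hp hA)]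
  congr 1
  ext x
  constructor
  · rintro ⟨h1, h2, h3⟩; exact ⟨h2, h3, h1⟩
  · rintro ⟨h1, h2, h3⟩; exact ⟨h3, h1, h2⟩

lemma smul_mem_coneS {p : ℝ} (hp : 2 ≤ p) {n : ℕ} {A : Set (EuclideanSpace ℝ (Fin n))}
    {x : EuclideanSpace ℝ (Fin n)} (hx : x ∈ A) (hS : lpNormE p x = 1) {c : ℝ} (c0 : 0 < c)
    (c1 : c ≤ 1) : c • x ∈ coneS p A := by
  have e : lpNormE p (c • x) = c := by rw [lpN_smul hp, hS, abs_of_pos c0, mul_one]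
  refine ⟨by rw [e]; exact c0, by rw [e]; exact c1, ?_⟩
  rw [e, inv_smul_smul₀ c0.ne']; exact hx

lemma vol_smul {n : ℕ} {r : ℝ} (hr : 0 < r) (X : Set (EuclideanSpace ℝ (Fin n))) :
    volume (r • X) = ENNReal.ofReal r ^ n * volume X := by
  rw [Measure.addHaar_smul, finrank_euclideanSpace_fin, abs_of_pos (by positivity),
    ENNReal.ofReal_pow hr.le]

lemma local_meas {p : ℝ} (hp : 2 ≤ p) {d : ℕ} {K : ENNReal}
    (hK : ∀ N : EuclideanSpace ℝ (Fin (d + 1)), ‖N‖ = 1 → ∀ s : ℝ, 0 < s →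
      ∀ Q : Set (EuclideanSpace ℝ (Fin (d + 1))), MeasurableSet Q → (∀ x ∈ Q, inner ℝ N x = s) →
      ENNReal.ofReal s * μH[(d:ℝ)] Q = K * volume (coneH N s Q))
    {x0 : EuclideanSpace ℝ (Fin (d + 1))} (hx0 : lpNormE p x0 = 1) {r : ℝ} (hr : 1 < r) :
    ∃ U ∈ nhds x0, ∀ A : Set (EuclideanSpace ℝ (Fin (d + 1))), MeasurableSet A → A ⊆ U →
      (∀ x ∈ A, lpNormE p x = 1) →
      μH[(d:ℝ)] A ≤ ENNReal.ofReal r ^ (2 * d + 2) *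
        (K * ∫⁻ x in A, ENNReal.ofReal ‖gP p x‖ ∂(mS p (d + 1))) ∧
      K * ∫⁻ x in A, ENNReal.ofReal ‖gP p x‖ ∂(mS p (d + 1)) ≤
        ENNReal.ofReal r ^ (2 * d + 2) * μH[(d:ℝ)] A := by
  obtain ⟨N, s, hN, s0, sH, U, hU, h1, h2⟩ := local_geom hp hx0 hr
  refine ⟨U, hU, fun A mA AU AS => ?_⟩
  have r0 : 0 < r := by linarith
  set prj : EuclideanSpace ℝ (Fin (d + 1)) → EuclideanSpace ℝ (Fin (d + 1)) :=
    fun x => (s / inner ℝ N x) • x with hpr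
  have inj : Set.InjOn prj A := by
    intro x hx y hy hxy
    have := (h2 x (AU hx) y (AU hy) (AS x hx) (AS y hy)).2
    change dist x y ≤ r * dist (prj x) (prj y) at this
    rw [hxy, dist_self, mul_zero] at this
    exact dist_le_zero.1 this
  have cont : ContinuousOn prj A := by
    have c1 : Continuous fun x : EuclideanSpace ℝ (Fin (d+1)) => inner ℝ N x := by fun_prop
    refine ContinuousOn.smul (ContinuousOn.div continuousOn_const c1.continuousOn ?_) continuousOn_id
    · intro x hx; exact (h1 x (AU hx)).1.ne'
  have mQ : MeasurableSet (prj '' A) := mA.image_of_continuousOn_injOn cont inj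
  have hQs : ∀ z ∈ prj '' A, inner ℝ N z = s := by
    rintro _ ⟨x, hx, rfl⟩
    have := (h1 x (AU hx)).1
    rw [hpr]; simp only
    rw [real_inner_smul_right]; field_simp
  have hc := hK N hN s s0 _ mQ hQs
  set g0 := ENNReal.ofReal ‖gP p x0‖ with hg0
  set ρ := ENNReal.ofReal r with hρ
  have hQ : μH[(d:ℝ)] (prj '' A) = g0 * K * volume (coneH N s (prj '' A)) := by
    rw [mul_assoc, ← hc, ← mul_assoc, hg0, ← ENNReal.ofReal_mul (norm_nonneg _), mul_comm _ s, sH]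
    simp
  have L1 : μH[(d:ℝ)] (prj '' A) ≤ ρ ^ d * μH[(d:ℝ)] A := by
    have : LipschitzOnWith r.toNNReal prj A := LipschitzOnWith.of_dist_le_mul fun x hx y hy => by
      rw [Real.coe_toNNReal r r0.le]
      exact (h2 x (AU hx) y (AU hy) (AS x hx) (AS y hy)).1
    have := this.hausdorffMeasure_image_le (d := (d:ℝ)) (by positivity)
    rwa [ENNReal.rpow_natCast] at this
  have L2 : μH[(d:ℝ)] A ≤ ρ ^ d * μH[(d:ℝ)] (prj '' A) := by
    have ginv : ∀ x ∈ A, (lpNormE p (prj x))⁻¹ • prj x = x := by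
      intro x hx
      have := (h1 x (AU hx)).1
      have q : 0 < s / inner ℝ N x := by positivity
      rw [hpr]; simp only
      rw [lpN_smul hp, AS x hx, abs_of_pos q, mul_one, inv_smul_smul₀ q.ne']
    have im : (fun z => (lpNormE p z)⁻¹ • z) '' (prj '' A) = A := by
      rw [Set.image_image]
      refine (Set.image_congr ginv).trans ?_
      simp
    have : LipschitzOnWith r.toNNReal (fun z => (lpNormE p z)⁻¹ • z) (prj '' A) := by
      refine LipschitzOnWith.of_dist_le_mul ?_
      rintro _ ⟨x, hx, rfl⟩ _ ⟨y, hy, rfl⟩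
      rw [ginv x hx, ginv y hy, Real.coe_toNNReal r r0.le]
      exact (h2 x (AU hx) y (AU hy) (AS x hx) (AS y hy)).2
    have := this.hausdorffMeasure_image_le (d := (d:ℝ)) (by positivity)
    rwa [ENNReal.rpow_natCast, im] at this
  have C1 : volume (coneH N s (prj '' A)) ≤ ρ ^ (d + 1) * mS p (d + 1) A := by
    rw [mS_apply hp mA, ← vol_smul r0]
    refine measure_mono ?_
    rintro y ⟨⟨y0, ys⟩, x, hx, hxy⟩
    obtain ⟨a0, a1, a2, -, -⟩ := h1 x (AU hx)
    rw [Set.mem_smul_set_iff_inv_smul_mem₀ r0.ne']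
    have e : y = (inner ℝ N y / inner ℝ N x) • x := by
      have : y = (inner ℝ N y / s) • ((s / inner ℝ N y) • y) := by
        rw [smul_smul]
        have : inner ℝ N y / s * (s / inner ℝ N y) = 1 := by field_simp
        rw [this, one_smul]
      calc y = (inner ℝ N y / s) • ((s / inner ℝ N y) • y) := this
        _ = (inner ℝ N y / s) • ((s / inner ℝ N x) • x) := by rw [← hxy]
        _ = _ := by rw [smul_smul]; congr 1; field_simp
    rw [e, smul_smul]
    refine smul_mem_coneS hp hx (AS x hx) (by positivity) ?_
    rw [inv_mul_le_iff₀ r0, mul_one]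
    exact le_trans (by gcongr) a1
  have C2 : mS p (d + 1) A ≤ ρ ^ (d + 1) * volume (coneH N s (prj '' A)) := by
    rw [mS_apply hp mA, ← vol_smul r0]
    refine measure_mono ?_
    rintro y ⟨y0, y1, hx⟩
    set x := (lpNormE p y)⁻¹ • y with hxd
    obtain ⟨a0, a1, a2, -, -⟩ := h1 x (AU hx)
    rw [Set.mem_smul_set_iff_inv_smul_mem₀ r0.ne']
    have e : y = lpNormE p y • x := by rw [hxd, smul_inv_smul₀ y0.ne']
    have ei : inner ℝ N (r⁻¹ • y) = r⁻¹ * (lpNormE p y * inner ℝ N x) := by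
      conv_lhs => rw [e]
      rw [real_inner_smul_right, real_inner_smul_right]
    refine ⟨⟨by rw [ei]; positivity, ?_⟩, x, hx, ?_⟩
    · rw [ei, inv_mul_le_iff₀ r0]
      rw [div_le_iff₀ s0] at a2
      nlinarith
    · rw [ei, hpr]
      simp only
      conv_rhs => rw [e]
      rw [← e, smul_smul, smul_smul]
      congr 1; field_simp
  have I1 : g0 * mS p (d + 1) A ≤ ρ * ∫⁻ x in A, ENNReal.ofReal ‖gP p x‖ ∂(mS p (d + 1)) := by
    have mg : Measurable fun x : EuclideanSpace ℝ (Fin (d+1)) => ENNReal.ofReal ‖gP p x‖ :=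
      (gP_continuous hp).norm.measurable.ennreal_ofReal
    rw [← setLIntegral_const, ← lintegral_const_mul _ mg]
    refine setLIntegral_mono (by fun_prop) fun x hx => ?_
    rw [hg0, hρ, ← ENNReal.ofReal_mul r0.le]
    exact ENNReal.ofReal_le_ofReal (h1 x (AU hx)).2.2.2.2
  have I2 : ∫⁻ x in A, ENNReal.ofReal ‖gP p x‖ ∂(mS p (d + 1)) ≤ ρ * (g0 * mS p (d + 1) A) := by
    rw [← mul_assoc, ← setLIntegral_const]
    refine setLIntegral_mono measurable_const fun x hx => ?_
    rw [hg0, hρ, ← ENNReal.ofReal_mul r0.le]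
    exact ENNReal.ofReal_le_ofReal (h1 x (AU hx)).2.2.2.1
  set I := ∫⁻ x in A, ENNReal.ofReal ‖gP p x‖ ∂(mS p (d + 1))
  constructor
  · calc μH[(d:ℝ)] A ≤ ρ ^ d * (g0 * K * volume (coneH N s (prj '' A))) := by rw [← hQ]; exact L2
      _ ≤ ρ ^ d * (g0 * K * (ρ ^ (d + 1) * mS p (d + 1) A)) := by gcongr
      _ = ρ ^ (2 * d + 1) * K * (g0 * mS p (d + 1) A) := by ring
      _ ≤ ρ ^ (2 * d + 1) * K * (ρ * I) := by gcongr
      _ = _ := by ring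
  · calc K * I ≤ K * (ρ * (g0 * (ρ ^ (d + 1) * volume (coneH N s (prj '' A))))) := by
          refine mul_le_mul_right (I2.trans ?_) _
          gcongr
      _ = ρ ^ (d + 2) * μH[(d:ℝ)] (prj '' A) := by rw [hQ]; ring
      _ ≤ ρ ^ (d + 2) * (ρ ^ d * μH[(d:ℝ)] A) := by gcongr
      _ = _ := by ring

lemma globalise {X : Type*} [TopologicalSpace X] [SecondCountableTopology X] [MeasurableSpace X]
    [OpensMeasurableSpace X] (μ ν : Measure X) (R : ENNReal) (S : Set X)
    (h : ∀ x ∈ S, ∃ U ∈ nhds x, ∀ A, MeasurableSet A → A ⊆ U → A ⊆ S → μ A ≤ R * ν A)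
    (A : Set X) (hA : MeasurableSet A) (hAS : A ⊆ S) : μ A ≤ R * ν A := by
  choose! U hU hUA using h
  obtain ⟨t, tS, tc, hcov⟩ := TopologicalSpace.countable_cover_nhdsWithin
    (f := fun x => interior (U x)) (s := S)
    (fun x hx => mem_nhdsWithin_of_mem_nhds (interior_mem_nhds.2 (hU x hx)))
  rcases Set.eq_empty_or_nonempty t with rfl | tn
  · have : A = ∅ := by
      rw [← Set.subset_empty_iff]; refine (hAS.trans hcov).trans ?_; simp
    rw [this]; simp
  obtain ⟨u, rfl⟩ := tc.exists_eq_range tn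
  set D := disjointed (fun k : ℕ => interior (U (u k))) with hD
  have mD : ∀ k, MeasurableSet (D k) := fun k =>
    MeasurableSet.disjointed (fun k => isOpen_interior.measurableSet) k
  have dj : Pairwise (Function.onFun Disjoint fun k => A ∩ D k) := fun i j hij =>
    (disjoint_disjointed (fun k : ℕ => interior (U (u k))) hij).mono Set.inter_subset_right
      Set.inter_subset_right
  have eA : A = ⋃ k, A ∩ D k := by
    rw [← Set.inter_iUnion, hD, iUnion_disjointed]
    refine (Set.inter_eq_left.2 ?_).symm
    refine (hAS.trans hcov).trans ?_
    simp
  have e1 : ∀ m : Measure X, m A = ∑' k, m (A ∩ D k) := fun m => by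
    conv_lhs => rw [eA]
    exact measure_iUnion dj fun k => hA.inter (mD k)
  rw [e1 μ, e1 ν, ← ENNReal.tsum_mul_left]
  refine ENNReal.tsum_le_tsum fun k => ?_
  refine hUA (u k) (tS ⟨k, rfl⟩) _ (hA.inter (mD k)) ?_ (Set.inter_subset_left.trans hAS)
  exact (Set.inter_subset_right.trans (disjointed_subset _ k)).trans interior_subset

lemma le_of_scale {a b : ENNReal} (m : ℕ) (h : ∀ r : ℝ, 1 < r → a ≤ ENNReal.ofReal r ^ m * b) :
    a ≤ b := by
  rcases eq_or_ne b ⊤ with rfl | hb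
  · exact le_top
  have t : Filter.Tendsto (fun r : ℝ => ENNReal.ofReal (r ^ m) * b) (nhdsWithin 1 (Set.Ioi 1))
      (nhds (ENNReal.ofReal (1 ^ m) * b)) := by
    refine ENNReal.Tendsto.mul_const ?_ (Or.inr hb)
    refine (ENNReal.tendsto_ofReal ?_)
    exact ((continuous_pow m).tendsto 1).mono_left nhdsWithin_le_nhds
  simp only [one_pow, ENNReal.ofReal_one, one_mul] at t
  refine ge_of_tendsto t ?_
  filter_upwards [self_mem_nhdsWithin] with r hr
  have hr : 1 < r := hr
  rw [ENNReal.ofReal_pow (by linarith)]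
  exact h r hr

/-- surface measure versus cone measure -/
theorem haus_cone {p : ℝ} (hp : 2 ≤ p) (d : ℕ) : ∃ K : ENNReal, K ≠ 0 ∧ K ≠ ⊤ ∧
    ∀ A : Set (EuclideanSpace ℝ (Fin (d + 1))), MeasurableSet A → (∀ x ∈ A, lpNormE p x = 1) →
      μH[(d:ℝ)] A = K * ∫⁻ x in A, ENNReal.ofReal ‖gP p x‖ ∂(mS p (d + 1)) := by
  obtain ⟨K, K0, Kt, hK⟩ := hyper d
  refine ⟨K, K0, Kt, fun A mA AS => ?_⟩
  set ν : Measure (EuclideanSpace ℝ (Fin (d + 1))) :=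
    K • (mS p (d + 1)).withDensity fun x => ENNReal.ofReal ‖gP p x‖ with hν
  have e : ∀ B, MeasurableSet B → ν B = K * ∫⁻ x in B, ENNReal.ofReal ‖gP p x‖ ∂(mS p (d + 1)) := by
    intro B hB
    rw [hν, Measure.smul_apply, smul_eq_mul, withDensity_apply _ hB]
  rw [← e A mA]
  apply le_antisymm
  · refine le_of_scale (2 * d + 2) fun r hr => ?_
    refine globalise μH[(d:ℝ)] ν _ {x | lpNormE p x = 1} (fun x hx => ?_) A mA AS
    obtain ⟨U, hU, h⟩ := local_meas hp hK hx hr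
    exact ⟨U, hU, fun B hB hBU hBS => by rw [e B hB]; exact (h B hB hBU hBS).1⟩
  · refine le_of_scale (2 * d + 2) fun r hr => ?_
    refine globalise ν μH[(d:ℝ)] _ {x | lpNormE p x = 1} (fun x hx => ?_) A mA AS
    obtain ⟨U, hU, h⟩ := local_meas hp hK hx hr
    exact ⟨U, hU, fun B hB hBU hBS => by rw [e B hB]; exact (h B hB hBU hBS).2⟩

end

section
open MeasureTheory Real
open scoped Pointwise
lemma psi0_meas {p : ℝ} (hp : 2 ≤ p) {n : ℕ} :
    Measurable (psi0 p : EuclideanSpace ℝ (Fin n) → ENNReal) := by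
  have hsm : Measurable (sP p : EuclideanSpace ℝ (Fin n) → ℝ) := (sP_continuous hp).measurable
  unfold psi0; fun_prop

lemma psi0_hom {p : ℝ} (hp : 2 ≤ p) {n : ℕ} {r : ℝ} (hr : 0 < r) (x : EuclideanSpace ℝ (Fin n)) :
    psi0 p (r • x) = psi0 p x := by
  unfold psi0
  congr 1
  have hrp : 0 < r ^ p := rpow_pos_of_pos hr _
  have : ∀ i, (|(r • x) i| ^ p) ^ 2 = (r ^ p) ^ 2 * (|x i| ^ p) ^ 2 := by
    intro i
    rw [PiLp.smul_apply, smul_eq_mul, abs_mul, mul_rpow (abs_nonneg _) (abs_nonneg _),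
      abs_of_pos hr, mul_pow]
  simp_rw [this]
  rw [← Finset.mul_sum, sP_smul hp, abs_of_pos hr, mul_pow, mul_div_mul_left _ _ (by positivity)]

lemma gP_sq {p : ℝ} (hp : 2 ≤ p) {n : ℕ} (x : EuclideanSpace ℝ (Fin n)) :
    ‖gP p x‖ ^ 2 = ∑ i, (|x i| ^ p) ^ (2 - 2 / p) := by
  have p0 : 0 < p := by linarith
  rw [EuclideanSpace.norm_sq_eq]
  refine Finset.sum_congr rfl fun i _ => ?_
  change ‖|x i| ^ (p - 2) * x i‖ ^ 2 = _
  rw [norm_mul, Real.norm_eq_abs, Real.norm_eq_abs, abs_of_nonneg (by positivity), ← rpow_mul (abs_nonneg _)]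
  rcases eq_or_ne (x i) 0 with h | h
  · rw [h, abs_zero, mul_zero, zero_rpow]
    · norm_num
    · field_simp; nlinarith
  · have := abs_pos.2 h
    rw [← rpow_add_one this.ne', ← rpow_natCast, ← rpow_mul this.le]
    congr 1
    push_cast
    field_simp
    ring

lemma gP_sq_le {p : ℝ} (hp : 2 ≤ p) {n : ℕ} {x : EuclideanSpace ℝ (Fin n)} (hx : lpNormE p x = 1) :
    ‖gP p x‖ ^ 2 ≤ (∑ i, (|x i| ^ p) ^ 2) ^ (1 - 2 / p) := by
  have p0 : 0 < p := by linarith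
  have th : 2 / p ≤ 1 := by rw [div_le_one p0]; exact hp
  have th0 : 0 < 2 / p := by positivity
  have hc := Real.concaveOn_rpow (p := 1 - 2 / p) (by linarith) (by linarith)
  have := hc.le_map_sum (t := Finset.univ) (w := fun i => |x i| ^ p) (p := fun i => |x i| ^ p)
    (fun i _ => by positivity) (sP_eq_one hp hx) (fun i _ => Set.mem_Ici.2 (by positivity))
  simp only [smul_eq_mul] at this
  rw [gP_sq hp]
  refine le_trans (le_of_eq ?_) (this.trans (le_of_eq ?_))
  · refine Finset.sum_congr rfl fun i _ => ?_
    rw [← rpow_one_add' (by positivity) (by linarith)]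
    congr 1; ring
  · congr 1; exact Finset.sum_congr rfl fun i _ => (sq _).symm

lemma gP_sq_ge {p : ℝ} (hp : 2 ≤ p) {n : ℕ} {x : EuclideanSpace ℝ (Fin n)} (hx : lpNormE p x = 1) :
    1 ≤ (n:ℝ) ^ (1 - 2 / p) * ‖gP p x‖ ^ 2 := by
  have p0 : 0 < p := by linarith
  have th : 2 / p ≤ 1 := by rw [div_le_one p0]; exact hp
  have := Real.rpow_sum_le_const_mul_sum_rpow_of_nonneg (Finset.univ : Finset (Fin n))
    (f := fun i => |x i| ^ p) (p := 2 - 2 / p) (by linarith) (fun i _ => by positivity)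
  have h1 : ∑ i, |x i| ^ p = 1 := sP_eq_one hp hx
  rw [h1, one_rpow, ← gP_sq hp] at this
  simp only [Finset.card_univ, Fintype.card_fin] at this
  convert this using 3
  ring

lemma sphere_meas {p : ℝ} (hp : 2 ≤ p) (n : ℕ) :
    MeasurableSet {x : EuclideanSpace ℝ (Fin n) | lpNormE p x = 1} :=
  (lpN_continuous hp).measurable (measurableSet_singleton 1)

lemma lpN_zero {p : ℝ} (hp : 2 ≤ p) {n : ℕ} : lpNormE p (0 : EuclideanSpace ℝ (Fin n)) = 0 :=
  (lpN_eq_zero hp).2 rfl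

lemma ball_vol_pos {p : ℝ} (hp : 2 ≤ p) (n : ℕ) :
    volume {x : EuclideanSpace ℝ (Fin n) | lpNormE p x ≤ 1} ≠ 0 := by
  have ho : IsOpen {x : EuclideanSpace ℝ (Fin n) | lpNormE p x < 1} :=
    isOpen_lt (lpN_continuous hp) continuous_const
  have : 0 < volume {x : EuclideanSpace ℝ (Fin n) | lpNormE p x < 1} :=
    ho.measure_pos _ ⟨0, by change lpNormE p _ < 1; rw [lpN_zero hp]; norm_num⟩
  refine (this.trans_le (measure_mono fun x hx => ?_)).ne'
  exact le_of_lt (show lpNormE p x < 1 from hx)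

lemma ball_vol_top {p : ℝ} (hp : 2 ≤ p) (n : ℕ) :
    volume {x : EuclideanSpace ℝ (Fin n) | lpNormE p x ≤ 1} ≠ ⊤ := by
  have p0 : 0 < p := by linarith
  have h1 := layer hp (fun _ : EuclideanSpace ℝ (Fin n) => 1) measurable_const (fun _ _ _ => rfl)
  simp only [one_mul, setLIntegral_one] at h1
  rw [lint_exp hp n] at h1
  intro h
  have r0 : radC p n ≠ 0 := by
    rw [radC_eq hp]; simp only [ne_eq, ENNReal.ofReal_eq_zero, not_le]; exact Gamma_pos_of_pos (by positivity)
  rw [h, ENNReal.mul_top r0] at h1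
  exact ENNReal.ofReal_ne_top h1

lemma mS_sphere {p : ℝ} (hp : 2 ≤ p) (d : ℕ) :
    mS p (d+1) {x | lpNormE p x = 1} = volume {x : EuclideanSpace ℝ (Fin (d+1)) | lpNormE p x ≤ 1} := by
  rw [mS_apply hp (sphere_meas hp _)]
  refine le_antisymm (measure_mono fun x hx => hx.2.1) ?_
  have : {x : EuclideanSpace ℝ (Fin (d+1)) | lpNormE p x ≤ 1} ⊆
      coneS p {x | lpNormE p x = 1} ∪ {0} := by
    intro x hx
    by_cases h : x = 0
    · right; exact h
    · left; exact ⟨lpN_pos hp h, hx, lpN_normalize hp (lpN_pos hp h)⟩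
  refine (measure_mono this).trans ((measure_union_le _ _).trans ?_)
  simp

lemma mS_univ {p : ℝ} (hp : 2 ≤ p) (d : ℕ) :
    mS p (d+1) Set.univ ≤ volume {x : EuclideanSpace ℝ (Fin (d+1)) | lpNormE p x ≤ 1} := by
  rw [mS_apply hp MeasurableSet.univ]
  exact measure_mono fun x hx => hx.2.1

lemma psi_mS {p : ℝ} (hp : 2 ≤ p) (d : ℕ) : ∫⁻ x, psi0 p x ∂(mS p (d+1)) ≤
    ENNReal.ofReal ((p + 1) / (d + 1)) *
      volume {x : EuclideanSpace ℝ (Fin (d+1)) | lpNormE p x ≤ 1} := by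
  have m1 := moment_lemma hp (Nat.succ_pos d)
  push_cast at m1
  refine le_trans ?_ m1
  unfold mS
  rw [lintegral_map (psi0_meas hp) (normalize_measurable hp)]
  have lm := (lpN_continuous hp (n := d+1)).measurable
  have mset : MeasurableSet {x : EuclideanSpace ℝ (Fin (d+1)) | 0 < lpNormE p x ∧ lpNormE p x ≤ 1} :=
    (measurableSet_lt measurable_const lm).inter (measurableSet_le lm measurable_const)
  rw [setLIntegral_congr_fun mset (g := fun x => psi0 p x)
    fun x hx => psi0_hom hp (inv_pos.2 hx.1) x]
  exact lintegral_mono_set fun x hx => hx.2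

lemma g_sq_int {p : ℝ} (hp : 2 ≤ p) (d : ℕ) :
    ∫⁻ x in {x | lpNormE p x = 1}, ENNReal.ofReal (‖gP p x‖ ^ 2) ∂(mS p (d+1)) ≤
      ENNReal.ofReal (((p + 1) / (d + 1)) ^ (1 - 2 / p)) *
      volume {x : EuclideanSpace ℝ (Fin (d+1)) | lpNormE p x ≤ 1} := by
  have p0 : 0 < p := by linarith
  have th : 2 / p ≤ 1 := by rw [div_le_one p0]; exact hp
  have th0 : 0 < 2 / p := by positivity
  set V := volume {x : EuclideanSpace ℝ (Fin (d+1)) | lpNormE p x ≤ 1}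
  set θ := 1 - 2 / p with hθ
  have θ0 : 0 ≤ θ := by linarith
  have θ1 : 0 ≤ 1 - θ := by rw [hθ]; linarith
  set a : ℝ := (p + 1) / (d + 1) with ha
  have a0 : 0 < a := by positivity
  have aθ : 0 < a ^ θ := rpow_pos_of_pos a0 _
  have pw : ∀ x ∈ {x : EuclideanSpace ℝ (Fin (d+1)) | lpNormE p x = 1},
      ENNReal.ofReal (‖gP p x‖ ^ 2) ≤
        ENNReal.ofReal (a ^ θ * (1 - θ)) + ENNReal.ofReal (a ^ θ * θ / a) * psi0 p x := by
    intro x hx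
    have hx : lpNormE p x = 1 := hx
    have s1 := sP_eq_one hp hx
    unfold psi0
    rw [s1, one_pow, div_one]
    set t := ∑ i, (|x i| ^ p) ^ 2
    have t0 : 0 ≤ t := Finset.sum_nonneg fun i _ => by positivity
    rw [← ENNReal.ofReal_mul (by positivity), ← ENNReal.ofReal_add (by positivity) (by positivity)]
    refine ENNReal.ofReal_le_ofReal ((gP_sq_le hp hx).trans ?_)
    have := Real.geom_mean_le_arith_mean2_weighted θ1 θ0 (zero_le_one) (by positivity : 0 ≤ t / a)
      (by ring)
    rw [one_rpow, one_mul, div_rpow t0 a0.le, div_le_iff₀ aθ] at this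
    refine this.trans (le_of_eq ?_)
    ring
  calc _ ≤ ∫⁻ x in {x | lpNormE p x = 1}, (ENNReal.ofReal (a ^ θ * (1 - θ)) +
        ENNReal.ofReal (a ^ θ * θ / a) * psi0 p x) ∂(mS p (d+1)) :=
        setLIntegral_mono (measurable_const.add (measurable_const.mul (psi0_meas hp))) pw
    _ ≤ ∫⁻ x, (ENNReal.ofReal (a ^ θ * (1 - θ)) +
        ENNReal.ofReal (a ^ θ * θ / a) * psi0 p x) ∂(mS p (d+1)) := setLIntegral_le_lintegral _ _
    _ = ENNReal.ofReal (a ^ θ * (1 - θ)) * mS p (d+1) Set.univ +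
        ENNReal.ofReal (a ^ θ * θ / a) * ∫⁻ x, psi0 p x ∂(mS p (d+1)) := by
        rw [lintegral_add_left measurable_const, lintegral_const,
          lintegral_const_mul _ (psi0_meas hp)]
    _ ≤ ENNReal.ofReal (a ^ θ * (1 - θ)) * V + ENNReal.ofReal (a ^ θ * θ / a) *
        (ENNReal.ofReal a * V) := by
        gcongr
        · exact mS_univ hp d
        · exact psi_mS hp d
    _ = _ := by
        rw [← mul_assoc, ← ENNReal.ofReal_mul (by positivity), ← add_mul,
          ← ENNReal.ofReal_add (by positivity) (by positivity)]
        congr 2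
        field_simp
        ring

noncomputable def wS (p : ℝ) (d : ℕ) (B : Set (EuclideanSpace ℝ (Fin (d+1)))) : ENNReal :=
  ∫⁻ x in B ∩ {x | lpNormE p x = 1}, ENNReal.ofReal ‖gP p x‖ ∂(mS p (d + 1))

lemma wS_sq {p : ℝ} (hp : 2 ≤ p) (d : ℕ) (B : Set (EuclideanSpace ℝ (Fin (d+1)))) :
    wS p d B ^ 2 ≤ ENNReal.ofReal (((p + 1) / (d + 1)) ^ (1 - 2 / p)) *
      volume {x : EuclideanSpace ℝ (Fin (d+1)) | lpNormE p x ≤ 1} *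
      mS p (d+1) (B ∩ {x | lpNormE p x = 1}) := by
  have mg : Measurable fun x : EuclideanSpace ℝ (Fin (d+1)) => ENNReal.ofReal ‖gP p x‖ :=
    (gP_continuous hp).norm.measurable.ennreal_ofReal
  have h := ENNReal.lintegral_mul_le_Lp_mul_Lq
    ((mS p (d+1)).restrict (B ∩ {x | lpNormE p x = 1})) Real.HolderConjugate.two_two
    (f := fun x => ENNReal.ofReal ‖gP p x‖) (g := fun _ => 1) mg.aemeasurable aemeasurable_const
  simp only [Pi.mul_apply, mul_one, ENNReal.one_rpow, lintegral_const, one_mul,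
    Measure.restrict_apply_univ] at h
  have h2 : wS p d B ^ 2 ≤ _ := pow_le_pow_left' h 2
  refine h2.trans ?_
  rw [mul_pow, ← ENNReal.rpow_natCast, ← ENNReal.rpow_natCast, ← ENNReal.rpow_mul, ← ENNReal.rpow_mul]
  norm_num
  gcongr
  refine le_trans ?_ (g_sq_int hp d)
  refine (lintegral_mono_set Set.inter_subset_right).trans (le_of_eq ?_)
  refine lintegral_congr fun x => ?_
  rw [ENNReal.ofReal_pow (norm_nonneg _)]
  simp

lemma wS_univ_sq {p : ℝ} (hp : 2 ≤ p) (d : ℕ) :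
    volume {x : EuclideanSpace ℝ (Fin (d+1)) | lpNormE p x ≤ 1} ^ 2 ≤
      ENNReal.ofReal (((d:ℝ) + 1) ^ (1 - 2 / p)) * wS p d Set.univ ^ 2 := by
  have mg : Measurable fun x : EuclideanSpace ℝ (Fin (d+1)) => ENNReal.ofReal ‖gP p x‖ :=
    (gP_continuous hp).norm.measurable.ennreal_ofReal
  set c : ℝ := (((d:ℝ) + 1) ^ (1 - 2 / p)) with hc
  have c0 : 0 ≤ c := by positivity
  have : ENNReal.ofReal c = ENNReal.ofReal (√c) ^ 2 := by
    rw [← ENNReal.ofReal_pow (sqrt_nonneg _), sq_sqrt c0]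
  rw [this, ← mul_pow]
  refine pow_le_pow_left' ?_ 2
  rw [← mS_sphere hp, wS, Set.univ_inter, ← lintegral_const_mul _ mg, ← setLIntegral_one]
  refine setLIntegral_mono (by fun_prop) fun x hx => ?_
  rw [← ENNReal.ofReal_mul (sqrt_nonneg _), ← ENNReal.ofReal_one]
  refine ENNReal.ofReal_le_ofReal ?_
  have h := gP_sq_ge hp hx
  push_cast at h
  rw [← hc] at h
  have : (1:ℝ) ≤ (√c * ‖gP p x‖) ^ 2 := by rw [mul_pow, sq_sqrt c0]; exact h
  have hh : 0 ≤ √c * ‖gP p x‖ := by positivity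
  nlinarith

lemma nu_eq {p : ℝ} (hp : 2 ≤ p) (d : ℕ) : wS p d Set.univ ≠ 0 ∧ wS p d Set.univ ≠ ⊤ ∧
    ∀ B, MeasurableSet B → surfaceMeasure p (d+1) B = (wS p d Set.univ)⁻¹ * wS p d B := by
  obtain ⟨K, K0, Kt, hK⟩ := haus_cone hp d
  have V0 := ball_vol_pos hp (d+1)
  have Vt := ball_vol_top hp (d+1)
  have w0 : wS p d Set.univ ≠ 0 := by
    intro h
    have := wS_univ_sq hp d
    rw [h] at this
    simp only [ne_eq, OfNat.ofNat_ne_zero, not_false_eq_true, zero_pow, mul_zero,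
      nonpos_iff_eq_zero, pow_eq_zero_iff] at this
    exact V0 this
  have wt : wS p d Set.univ ≠ ⊤ := by
    intro h
    have := wS_sq hp d Set.univ
    rw [h, Set.univ_inter, mS_sphere hp] at this
    have t : ENNReal.ofReal (((p + 1) / (d + 1)) ^ (1 - 2 / p)) *
      volume {x : EuclideanSpace ℝ (Fin (d+1)) | lpNormE p x ≤ 1} *
      volume {x : EuclideanSpace ℝ (Fin (d+1)) | lpNormE p x ≤ 1} ≠ ⊤ := by finiteness
    apply t
    rw [← top_le_iff]
    refine le_trans ?_ this
    simp
  refine ⟨w0, wt, fun B hB => ?_⟩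
  have hd : ((d + 1 : ℕ) : ℝ) - 1 = d := by push_cast; ring
  unfold surfaceMeasure
  rw [Measure.smul_apply, smul_eq_mul, Measure.restrict_apply hB, hd,
    hK _ (sphere_meas hp _) (fun x hx => hx),
    hK _ (hB.inter (sphere_meas hp _)) (fun x hx => hx.2)]
  have e : ∫⁻ x in {x | lpNormE p x = 1}, ENNReal.ofReal ‖gP p x‖ ∂(mS p (d + 1)) =
      wS p d Set.univ := by rw [wS, Set.univ_inter]
  rw [e]
  change (K * wS p d Set.univ)⁻¹ * (K * wS p d B) = _
  rw [ENNReal.mul_inv (Or.inl K0) (Or.inl Kt)]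
  calc _ = (K⁻¹ * K) * ((wS p d Set.univ)⁻¹ * wS p d B) := by ring
    _ = _ := by rw [ENNReal.inv_mul_cancel K0 Kt, one_mul]

lemma nu_prob {p : ℝ} (hp : 2 ≤ p) (d : ℕ) : IsProbabilityMeasure (surfaceMeasure p (d+1)) := by
  obtain ⟨w0, wt, h⟩ := nu_eq hp d
  exact ⟨by rw [h _ MeasurableSet.univ, ENNReal.inv_mul_cancel w0 wt]⟩

lemma nu_sq {p : ℝ} (hp : 2 ≤ p) (d : ℕ) {B : Set (EuclideanSpace ℝ (Fin (d+1)))}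
    (hB : MeasurableSet B) : surfaceMeasure p (d+1) B ^ 2 *
      volume {x : EuclideanSpace ℝ (Fin (d+1)) | lpNormE p x ≤ 1} ≤
      ENNReal.ofReal ((p + 1) ^ (1 - 2 / p)) * mS p (d+1) (B ∩ {x | lpNormE p x = 1}) := by
  obtain ⟨w0, wt, h⟩ := nu_eq hp d
  have h1 := wS_sq hp d B
  have h2 := wS_univ_sq hp d
  have V0 := ball_vol_pos hp (d+1)
  have Vt := ball_vol_top hp (d+1)
  have p0 : 0 < p := by linarith
  set V := volume {x : EuclideanSpace ℝ (Fin (d+1)) | lpNormE p x ≤ 1}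
  set W := wS p d Set.univ
  set m := mS p (d+1) (B ∩ {x | lpNormE p x = 1})
  have e0 : surfaceMeasure p (d+1) B * W = wS p d B := by
    rw [h B hB, mul_comm, ← mul_assoc, ENNReal.mul_inv_cancel w0 wt, one_mul]
  set b := surfaceMeasure p (d+1) B
  set θ := 1 - 2 / p
  rw [← e0] at h1
  have hP : ENNReal.ofReal (((p + 1) / (d + 1)) ^ θ) * ENNReal.ofReal (((d:ℝ) + 1) ^ θ) =
      ENNReal.ofReal ((p + 1) ^ θ) := by
    rw [← ENNReal.ofReal_mul (by positivity), ← mul_rpow (by positivity) (by positivity)]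
    congr 2; field_simp
  have key : (V * W ^ 2) * (b ^ 2 * V) ≤ (V * W ^ 2) * (ENNReal.ofReal ((p + 1) ^ θ) * m) := by
    calc (V * W ^ 2) * (b ^ 2 * V) = (b * W) ^ 2 * V ^ 2 := by ring
      _ ≤ (ENNReal.ofReal (((p + 1) / (d + 1)) ^ θ) * V * m) *
          (ENNReal.ofReal (((d:ℝ) + 1) ^ θ) * W ^ 2) := by gcongr
      _ = _ := by rw [← hP]; ring
  refine (ENNReal.mul_le_mul_iff_right ?_ ?_).1 key
  · exact mul_ne_zero V0 (pow_ne_zero 2 w0)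
  · finiteness

theorem two_set_nu {p : ℝ} (hp : 2 ≤ p) (d : ℕ) {A A' : Set (EuclideanSpace ℝ (Fin (d+1)))}
    (hA : MeasurableSet A) (hA' : MeasurableSet A') {t : ℝ} (ht : 0 ≤ t)
    (hd : ∀ x ∈ A, ∀ x' ∈ A', t ≤ lpNormE p (x - x')) :
    surfaceMeasure p (d+1) A * surfaceMeasure p (d+1) A' ≤
      ENNReal.ofReal ((p + 1) ^ (1 - 2 / p) * exp (-((3/4) * (t/2) ^ p / p)) ^ (d+1)) := by
  have h1 := nu_sq hp d hA
  have h2 := nu_sq hp d hA'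
  have hS := sphere_meas hp (d+1)
  have h3 := two_set hp (hA.inter hS) (hA'.inter hS) ht
    (fun x hx x' hx' => hd x hx.1 x' hx'.1)
  rw [← mS_apply hp (hA.inter hS), ← mS_apply hp (hA'.inter hS)] at h3
  have V0 := ball_vol_pos hp (d+1)
  have Vt := ball_vol_top hp (d+1)
  set V := volume {x : EuclideanSpace ℝ (Fin (d+1)) | lpNormE p x ≤ 1}
  rw [ENNReal.ofReal_mul (by positivity)]
  set E := ENNReal.ofReal (exp (-((3/4) * (t/2) ^ p / p)) ^ (d+1))
  set P := ENNReal.ofReal ((p + 1) ^ (1 - 2 / p))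
  set a := surfaceMeasure p (d+1) A
  set b := surfaceMeasure p (d+1) A'
  have key : V ^ 2 * (a * b) ^ 2 ≤ V ^ 2 * (P * E) ^ 2 := by
    calc V ^ 2 * (a * b) ^ 2 = (a ^ 2 * V) * (b ^ 2 * V) := by ring
      _ ≤ (P * mS p (d+1) (A ∩ {x | lpNormE p x = 1})) * (P * mS p (d+1) (A' ∩ {x | lpNormE p x = 1})) := by
        gcongr
      _ = P ^ 2 * (mS p (d+1) (A ∩ {x | lpNormE p x = 1}) * mS p (d+1) (A' ∩ {x | lpNormE p x = 1})) := by
        ring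
      _ ≤ P ^ 2 * (E * V) ^ 2 := by gcongr
      _ = _ := by ring
  have k2 := (ENNReal.mul_le_mul_iff_right (pow_ne_zero 2 V0) (by finiteness)).1 key
  exact (ENNReal.pow_le_pow_left_iff (by norm_num)).1 k2

end

section
open MeasureTheory Real
section P6
variable {Ω : Type*} [MeasurableSpace Ω]

lemma exists_med (ν : Measure Ω) [IsProbabilityMeasure ν] {f : Ω → ℝ} (hf : Measurable f) {c : ℝ}
    (hb : ∀ᵐ x ∂ν, |f x - c| ≤ 1) :
    ∃ M, 1/2 ≤ ν {x | f x ≤ M} ∧ 1/2 ≤ ν {x | M ≤ f x} := by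
  set S : Set ℝ := {a | 1/2 ≤ ν {x | f x ≤ a}} with hS
  have h1 : c + 1 ∈ S := by
    change 1/2 ≤ ν {x | f x ≤ c + 1}
    have : ν {x | f x ≤ c + 1} = 1 := by
      rw [← measure_univ (μ := ν)]
      apply measure_congr
      filter_upwards [hb] with x hx
      have : f x ≤ c + 1 := by linarith [(abs_le.1 hx).2]
      exact propext ⟨fun _ => trivial, fun _ => this⟩
    rw [this]
    simp
  have h2 : BddBelow S := by
    refine ⟨c - 2, fun a ha => ?_⟩
    by_contra hlt
    push Not at hlt
    have h0 : ν {x | f x ≤ a} = 0 := by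
      rw [measure_eq_zero_iff_ae_notMem]
      filter_upwards [hb] with x hx
      change ¬ (f x ≤ a)
      linarith [(abs_le.1 hx).1]
    have ha' : 1/2 ≤ ν {x | f x ≤ a} := ha
    rw [h0] at ha'
    simp at ha'
  have hup : ∀ a, sInf S < a → a ∈ S := by
    intro a ha
    obtain ⟨b, hb, hba⟩ := exists_lt_of_csInf_lt ⟨_, h1⟩ ha
    exact le_trans hb (measure_mono fun x (hx : f x ≤ b) => (hx.trans hba.le : f x ≤ a))
  have hu := tendsto_one_div_add_atTop_nhds_zero_nat (𝕜 := ℝ)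
  refine ⟨sInf S, ?_, ?_⟩
  · have e : {x | f x ≤ sInf S} = ⋂ k : ℕ, {x | f x ≤ sInf S + 1 / ((k:ℝ)+1)} := by
      ext x
      simp only [Set.mem_iInter]
      constructor
      · intro h k
        have h' : f x ≤ sInf S := h
        have : (0:ℝ) < 1 / ((k:ℝ)+1) := by positivity
        change f x ≤ _
        linarith
      · intro h
        have := hu.const_add (sInf S)
        rw [add_zero] at this
        exact ge_of_tendsto' this h
    rw [e]
    have hT := tendsto_measure_iInter_atTop (μ := ν) (s := fun k : ℕ => {x | f x ≤ sInf S + 1 / ((k:ℝ)+1)})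
      (fun k => (measurableSet_le hf measurable_const).nullMeasurableSet)
      (fun i j hij x (hx : f x ≤ _) => by
        change f x ≤ _
        have : 1 / ((j:ℝ)+1) ≤ 1 / ((i:ℝ)+1) := by gcongr
        linarith) ⟨0, by finiteness⟩
    refine ge_of_tendsto' hT fun k => hup _ ?_
    have : (0:ℝ) < 1 / ((k:ℝ)+1) := by positivity
    linarith
  · have e : {x | f x < sInf S} = ⋃ k : ℕ, {x | f x ≤ sInf S - 1 / ((k:ℝ)+1)} := by
      ext x
      simp only [Set.mem_iUnion]
      constructor
      · intro h
        have h' : 0 < sInf S - f x := sub_pos.2 h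
        obtain ⟨k, hk⟩ := exists_nat_one_div_lt h'
        exact ⟨k, by change f x ≤ _; linarith⟩
      · rintro ⟨k, hk⟩
        have h' : f x ≤ sInf S - 1 / ((k:ℝ)+1) := hk
        have : (0:ℝ) < 1 / ((k:ℝ)+1) := by positivity
        change f x < _
        linarith
    have hle : ν {x | f x < sInf S} ≤ 1/2 := by
      rw [e]
      have hT := tendsto_measure_iUnion_atTop (μ := ν) (s := fun k : ℕ => {x | f x ≤ sInf S - 1 / ((k:ℝ)+1)})
        (fun i j hij x (hx : f x ≤ _) => by
          change f x ≤ _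
          have : 1 / ((j:ℝ)+1) ≤ 1 / ((i:ℝ)+1) := by gcongr
          linarith)
      refine le_of_tendsto' hT fun k => ?_
      by_contra hlt
      push Not at hlt
      have : (0:ℝ) < 1 / ((k:ℝ)+1) := by positivity
      have := csInf_le h2 (show sInf S - 1 / ((k:ℝ)+1) ∈ S from hlt.le)
      linarith
    have hc : {x | sInf S ≤ f x} = {x | f x < sInf S}ᶜ := by
      ext x; simp
    rw [hc, prob_compl_eq_one_sub (measurableSet_lt hf measurable_const)]
    refine ENNReal.le_sub_of_add_le_left (by finiteness) ?_
    calc _ ≤ (1/2 : ENNReal) + 1/2 := by gcongr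
      _ = 1 := by simp [ENNReal.inv_two_add_inv_two]

lemma half_mul {a b Q : ENNReal} (ha : 1/2 ≤ a) (h : a * b ≤ Q) : b ≤ 2 * Q := by
  calc b = 2 * (1/2 * b) := by
        rw [← mul_assoc, one_div, ENNReal.mul_inv_cancel (by norm_num) (by norm_num), one_mul]
    _ ≤ 2 * (a * b) := by gcongr
    _ ≤ _ := by gcongr

/-- integral bound from an exponential tail -/
lemma tail_int (ν : Measure Ω) [IsProbabilityMeasure ν] {Y : Ω → ℝ} (hY : Integrable Y ν)
    {L : ℝ} (hT : ∀ s, 0 ≤ s → ν {x | L + s ≤ Y x} ≤ ENNReal.ofReal (exp (-s))) :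
    ∫ x, Y x ∂ν ≤ L + 1 := by
  have hZ : Integrable (fun x => max (Y x - L) 0) ν := (hY.sub (integrable_const L)).pos_part
  have h1 : ∫ x, max (Y x - L) 0 ∂ν ≤ 1 := by
    have h0 : 0 ≤ᵐ[ν] (fun x => max (Y x - L) 0) := Filter.Eventually.of_forall fun x => le_max_right _ _
    rw [integral_eq_lintegral_of_nonneg_ae h0
      hZ.aestronglyMeasurable]
    refine ENNReal.toReal_le_of_le_ofReal zero_le_one ?_
    rw [lintegral_eq_lintegral_meas_le ν h0
      hZ.aemeasurable]
    calc _ ≤ ∫⁻ s in Set.Ioi (0:ℝ), ENNReal.ofReal (exp (-s)) := by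
          refine setLIntegral_mono (by fun_prop) fun s (hs : 0 < s) => ?_
          refine le_trans (measure_mono fun x (hx : s ≤ max (Y x - L) 0) => ?_) (hT s hs.le)
          change L + s ≤ Y x
          rcases le_max_iff.1 hx with h | h <;> linarith
      _ = ENNReal.ofReal (∫ s in Set.Ioi (0:ℝ), exp (-s)) := by
          rw [ofReal_integral_eq_lintegral_ofReal (integrableOn_exp_neg_Ioi 0)
            (Filter.Eventually.of_forall fun x => (exp_pos _).le)]
      _ = ENNReal.ofReal 1 := by rw [integral_exp_neg_Ioi_zero]
  calc ∫ x, Y x ∂ν ≤ ∫ x, (max (Y x - L) 0 + L) ∂ν := by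
        refine integral_mono hY (hZ.add (integrable_const L)) fun x => ?_
        have := le_max_left (Y x - L) 0
        change Y x ≤ max (Y x - L) 0 + L
        linarith
    _ = (∫ x, max (Y x - L) 0 ∂ν) + L := by
        rw [integral_add hZ (integrable_const L)]; simp
    _ ≤ _ := by linarith

theorem abstract_conc (ν : Measure Ω) [IsProbabilityMeasure ν] {f : Ω → ℝ} (hf : Measurable f) {c : ℝ}
    (hb : ∀ᵐ x ∂ν, |f x - c| ≤ 1) {p P α γ : ℝ} (hp : 2 ≤ p) (hP : 1 ≤ P) (hα : 0 < α) (hγ : 0 ≤ γ)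
    (hγα : γ * 2 ^ p * 9 ≤ α)
    (hT : ∀ a t : ℝ, 0 ≤ t → ν {x | f x ≤ a} * ν {x | a + t ≤ f x} ≤
      ENNReal.ofReal (P * exp (-(α * t ^ p)))) (t : ℝ) (ht : 0 ≤ t) :
    ν {x | t ≤ |f x - ∫ y, f y ∂ν|} ≤ ENNReal.ofReal (2 * P * exp (-(γ * t ^ p))) := by
  obtain ⟨M, hM1, hM2⟩ := exists_med ν hf hb
  have tail : ∀ u, 0 ≤ u → ν {x | u ≤ |f x - M|} ≤ ENNReal.ofReal (4 * P * exp (-(α * u ^ p))) := by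
    intro u hu
    have a1 := half_mul hM1 (hT M u hu)
    have a2 := hT (M - u) u hu
    rw [mul_comm, sub_add_cancel] at a2
    have a2 := half_mul hM2 a2
    calc _ ≤ ν ({x | M + u ≤ f x} ∪ {x | f x ≤ M - u}) := by
          refine measure_mono fun x (hx : u ≤ |f x - M|) => ?_
          rcases le_abs.1 hx with h | h
          · left; change M + u ≤ f x; linarith
          · right; change f x ≤ M - u; linarith
      _ ≤ _ := measure_union_le _ _
      _ ≤ 2 * ENNReal.ofReal (P * exp (-(α * u ^ p))) + 2 * ENNReal.ofReal (P * exp (-(α * u ^ p))) := by gcongr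
      _ = ENNReal.ofReal 4 * ENNReal.ofReal (P * exp (-(α * u ^ p))) := by
          rw [← add_mul]; congr 1; rw [ENNReal.ofReal_ofNat]; norm_num
      _ = _ := by rw [← ENNReal.ofReal_mul (by norm_num)]; congr 1; ring
  have hfi : Integrable f ν := by
    refine Integrable.of_bound hf.aestronglyMeasurable (|c| + 1) ?_
    filter_upwards [hb] with x hx
    have := abs_sub_abs_le_abs_sub (f x) c
    rw [Real.norm_eq_abs]; linarith
  have hXi : Integrable (fun x => |f x - M|) ν := (hfi.sub (integrable_const M)).abs
  have hXp : Integrable (fun x => |f x - M| ^ p) ν := by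
    refine Integrable.of_bound
      ((hf.sub_const M).norm.pow_const p).aestronglyMeasurable ((1 + |c - M|) ^ p) ?_
    filter_upwards [hb] with x hx
    rw [Real.norm_eq_abs, abs_of_nonneg (by positivity)]
    gcongr
    calc |f x - M| = |(f x - c) + (c - M)| := by ring_nf
      _ ≤ _ := (abs_add_le _ _).trans (by gcongr)
  set δ := ∫ x, |f x - M| ∂ν with hδ
  have hδ0 : 0 ≤ δ := integral_nonneg fun x => abs_nonneg _
  have hδp : α * δ ^ p ≤ log (4 * P) + 1 := by
    have j : δ ^ p ≤ ∫ x, |f x - M| ^ p ∂ν :=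
      (convexOn_rpow (by linarith : 1 ≤ p)).map_integral_le
        (continuousOn_id.rpow_const fun x _ => Or.inr (by linarith)) isClosed_Ici
        (Filter.Eventually.of_forall fun x => (abs_nonneg (f x - M) : 0 ≤ |f x - M|)) hXi hXp
    have k := tail_int ν (hXp.const_mul α) (L := log (4 * P)) (fun s hs => by
      have hL : 0 ≤ log (4 * P) := log_nonneg (by linarith)
      have := tail (((log (4*P) + s) / α) ^ (1/p)) (by positivity)
      have e : (((log (4*P) + s) / α) ^ (1/p)) ^ p = (log (4*P) + s) / α := by
        rw [← rpow_mul (by positivity), one_div_mul_cancel (by linarith), rpow_one]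
      rw [e, mul_div_cancel₀ _ hα.ne', neg_add, exp_add, exp_neg (log _), exp_log (by linarith),
        ← mul_assoc, mul_inv_cancel₀ (by linarith), one_mul] at this
      refine le_trans (measure_mono fun x (hx : log (4*P) + s ≤ α * |f x - M| ^ p) => ?_) this
      change _ ≤ |f x - M|
      have h1 : (log (4*P) + s) / α ≤ |f x - M| ^ p := by
        rw [div_le_iff₀ hα]; linarith
      calc _ ≤ (|f x - M| ^ p) ^ (1/p) := by gcongr
        _ = _ := by rw [← rpow_mul (abs_nonneg _), mul_one_div_cancel (by linarith), rpow_one])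
    rw [integral_const_mul] at k
    exact le_trans (by gcongr) k
  have hdM : |M - ∫ y, f y ∂ν| ≤ δ := by
    have : (∫ y, f y ∂ν) - M = ∫ y, (f y - M) ∂ν := by
      rw [integral_sub hfi (integrable_const M)]; simp
    rw [abs_sub_comm, this]
    exact abs_integral_le_integral_abs
  have hl2 : 0.69 < log 2 := by have := Real.log_two_gt_d9; linarith
  have hlP : log (2 * P) = log 2 + log P := log_mul (by norm_num) (by linarith)
  have hlP4 : log (4 * P) = log 2 + log (2 * P) := by
    rw [← log_mul (by norm_num) (by positivity)]; congr 1; ring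
  have hP0 : 0 ≤ log P := log_nonneg hP
  by_cases hcase : 2 * δ ≤ t
  · have hs : γ * t ^ p * 9 ≤ α * (t/2) ^ p := by
      rw [div_rpow ht (by norm_num), mul_div_assoc', le_div_iff₀ (by positivity)]
      calc _ = γ * 2 ^ p * 9 * t ^ p := by ring
        _ ≤ _ := by gcongr
    have hs0 : 0 ≤ γ * t ^ p := by positivity
    have hν : ν {x | t ≤ |f x - ∫ y, f y ∂ν|} ≤ ENNReal.ofReal (4 * P * exp (-(α * (t/2) ^ p))) := by
      refine le_trans (measure_mono fun x (hx : t ≤ |f x - ∫ y, f y ∂ν|) => ?_) (tail (t/2) (by linarith))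
      change t/2 ≤ |f x - M|
      have : |f x - ∫ y, f y ∂ν| ≤ |f x - M| + |M - ∫ y, f y ∂ν| := abs_sub_le _ _ _
      linarith
    by_cases h1 : 1 ≤ 2 * P * exp (-(γ * t ^ p))
    · exact prob_le_one.trans (by rw [← ENNReal.ofReal_one]; exact ENNReal.ofReal_le_ofReal h1)
    · push Not at h1
      refine hν.trans (ENNReal.ofReal_le_ofReal ?_)
      set z := exp (-(γ * t ^ p)) with hz
      have hz0 : 0 < z := exp_pos _
      have : exp (-(α * (t/2) ^ p)) ≤ z * z := by
        rw [hz, ← exp_add]; gcongr; linarith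
      calc 4 * P * exp (-(α * (t/2) ^ p)) ≤ 4 * P * (z * z) := by gcongr
        _ ≤ (2 * P * z) * (2 * P * z) := by nlinarith [mul_pos hz0 hz0]
        _ ≤ (2 * P * z) * 1 := by gcongr
        _ = _ := mul_one _
  · push Not at hcase
    refine prob_le_one.trans ?_
    rw [← ENNReal.ofReal_one]
    refine ENNReal.ofReal_le_ofReal ?_
    have h9 : γ * t ^ p * 9 ≤ α * δ ^ p := by
      calc γ * t ^ p * 9 ≤ γ * (2 * δ) ^ p * 9 := by gcongr
        _ = γ * 2 ^ p * 9 * δ ^ p := by rw [mul_rpow (by norm_num) hδ0]; ring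
        _ ≤ _ := by gcongr
    have : γ * t ^ p ≤ log (2 * P) := by linarith
    calc 1 = 2 * P * exp (-(log (2 * P))) := by
          rw [exp_neg, exp_log (by positivity), mul_inv_cancel₀ (by positivity)]
      _ ≤ _ := by gcongr

end P6

theorem final_conc (p : ℝ) (hp : 2 ≤ p) (q : ℝ) (hq : q = p / (p - 1))
    (n : ℕ) (hn : 3 ≤ n)
    (f : EuclideanSpace ℝ (Fin n) → ℝ)
    (hf : ∀ x y : EuclideanSpace ℝ (Fin n), |f x - f y| ≤ lpNormE p (x - y))
    (t : ℝ) (ht : 0 ≤ t) :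
    surfaceMeasure p n {x | t ≤ |f x - ∫ y, f y ∂(surfaceMeasure p n)|} ≤
      ENNReal.ofReal (2 * (p + 1) ^ (1 - 2 / p) * Real.exp
        (-((q - 1) ^ p / (3 ^ (p - 1) * 8 ^ p * q)) * n * t ^ p)) := by
  obtain ⟨d, rfl⟩ : ∃ d, n = d + 1 := ⟨n - 1, by omega⟩
  have := nu_prob hp d
  have hp1 : 0 < p - 1 := by linarith
  have hq1 : 1 < q := by rw [hq, lt_div_iff₀ hp1]; linarith
  have hcont : Continuous f := by
    rw [continuous_iff_continuousAt]
    intro x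
    rw [ContinuousAt, tendsto_iff_norm_sub_tendsto_zero]
    have h0 : Filter.Tendsto (fun y => lpNormE p (y - x)) (nhds x) (nhds 0) := by
      have := ((lpN_continuous hp).comp (continuous_id.sub (continuous_const (y := x)))).tendsto x
      change Filter.Tendsto (fun y => lpNormE p (y - x)) (nhds x) (nhds (lpNormE p (x - x))) at this
      simpa [lpN_zero hp] using this
    exact squeeze_zero (fun _ => norm_nonneg _) (fun y => by simpa using hf y x) h0
  have hb : ∀ᵐ x ∂(surfaceMeasure p (d+1)), |f x - f 0| ≤ 1 := by
    unfold surfaceMeasure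
    refine Measure.ae_smul_measure ?_ _
    filter_upwards [ae_restrict_mem (sphere_meas hp (d+1))] with x hx
    have := hf x 0
    rw [sub_zero] at this
    exact this.trans (le_of_eq hx)
  set γ := (q - 1) ^ p / (3 ^ (p - 1) * 8 ^ p * q) * ((d+1 : ℕ) : ℝ) with hγ
  set α := (3/4) / (2 ^ p * p) * ((d+1 : ℕ) : ℝ) with hα
  have hq0 : 0 < q - 1 := by linarith
  have hqpos : 0 < q := by linarith
  have hN : (0:ℝ) < ((d+1 : ℕ) : ℝ) := by positivity
  have key : (q - 1) ^ p / (3 ^ (p - 1) * 8 ^ p * q) * 2 ^ p * 9 ≤ (3/4) / (2 ^ p * p) := by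
    have e1 : (q - 1) ^ p ≤ q / p := by
      have e : q - 1 = 1 / (p - 1) := by rw [hq]; field_simp; ring
      have e2 : q / p = q - 1 := by rw [e, hq]; field_simp
      rw [e2]
      have hle : q - 1 ≤ 1 := by rw [e, div_le_one hp1]; linarith
      calc (q-1) ^ p ≤ (q-1) ^ (1:ℝ) := rpow_le_rpow_of_exponent_ge hq0 hle (by linarith)
        _ = _ := rpow_one _
    have e3 : (3:ℝ) ^ (p - 1) = 3 ^ p / 3 := by rw [rpow_sub (by norm_num), rpow_one]
    have e8 : (8:ℝ) ^ p = 2 ^ p * 2 ^ p * 2 ^ p := by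
      rw [← mul_rpow (by norm_num) (by norm_num), ← mul_rpow (by norm_num) (by norm_num)]; norm_num
    have e36 : (36:ℝ) ≤ 2 ^ p * 3 ^ p := by
      rw [← mul_rpow (by norm_num) (by norm_num)]
      calc (36:ℝ) = (2*3) ^ (2:ℝ) := by norm_num
        _ ≤ _ := rpow_le_rpow_of_exponent_le (by norm_num) hp
    have hp0 : 0 < p := by linarith
    rw [e3, e8]
    have h2 : (0:ℝ) < 2 ^ p := by positivity
    have h3 : (0:ℝ) < 3 ^ p := by positivity
    generalize (2:ℝ) ^ p = a at *
    generalize (3:ℝ) ^ p = b at *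
    calc (q - 1) ^ p / (b / 3 * (a * a * a) * q) * a * 9 ≤ (q / p) / (b / 3 * (a * a * a) * q) * a * 9 := by
          gcongr
      _ = 27 / (a * b) / (a * p) := by field_simp; norm_num
      _ ≤ 27 / 36 / (a * p) := by gcongr
      _ = _ := by norm_num
  have main := abstract_conc (surfaceMeasure p (d+1)) hcont.measurable hb (p := p)
    (P := (p+1) ^ (1 - 2/p)) (α := α) (γ := γ) hp
    (one_le_rpow (by linarith) (by rw [sub_nonneg, div_le_one (by linarith)]; exact hp))
    (by positivity) (by positivity)
    (by
      calc γ * 2 ^ p * 9 = (q - 1) ^ p / (3 ^ (p - 1) * 8 ^ p * q) * 2 ^ p * 9 * ((d+1 : ℕ) : ℝ) := by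
            rw [hγ]; ring
        _ ≤ _ := by rw [hα]; gcongr)
    (fun a s hs => by
      have := two_set_nu hp d (A := {x | f x ≤ a}) (A' := {x | a + s ≤ f x})
        (measurableSet_le hcont.measurable measurable_const)
        (measurableSet_le measurable_const hcont.measurable) hs
        (fun x (hx : f x ≤ a) x' (hx' : a + s ≤ f x') => by
          have := (abs_le.1 (hf x x')).1
          linarith)
      refine this.trans (le_of_eq ?_)
      congr 2
      rw [← exp_nat_mul]
      congr 1
      rw [div_rpow hs (by norm_num), hα]
      have : (0:ℝ) < 2 ^ p := by positivity
      field_simp) t ht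
  refine main.trans (le_of_eq ?_)
  congr 3
  rw [hγ]; ring

end

/-- Proposition 4.3: first order concentration for the surface measure on the
`ℓ_p`-sphere for functions which are `1`-Lipschitz with respect to the `ℓ_p`-norm. -/
theorem lipschitz_concentration_surface (p : ℝ) (hp : 2 ≤ p) (q : ℝ) (hq : q = p / (p - 1))
    (n : ℕ) (hn : 3 ≤ n)
    (f : EuclideanSpace ℝ (Fin n) → ℝ)
    (hf : ∀ x y : EuclideanSpace ℝ (Fin n), |f x - f y| ≤ lpNormE p (x - y))
    (t : ℝ) (ht : 0 ≤ t) :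
    surfaceMeasure p n {x | t ≤ |f x - ∫ y, f y ∂(surfaceMeasure p n)|} ≤
      ENNReal.ofReal (2 * (p + 1) ^ (1 - 2 / p) * Real.exp
        (-((q - 1) ^ p / (3 ^ (p - 1) * 8 ^ p * q)) * n * t ^ p)) := by
  exact final_conc p hp q hq n hn f hf t ht
end

section
/- Let p ≥ 2 be real. Then ( ∫_{S_p^{n−1}} |θ^{p−1}|₂² dμ_{p,n} )^{1/2} ≤ (p+1)^{1/2 − 1/p} · ∫_{S_p^{n−1}} |θ^{p−1}|₂ dμ_{p,n}, where θ^{p−1} := (sign(θ_1)|θ_1|^{p−1}, …, sign(θ_n)|θ_n|^{p−1}) and |·|₂ is the Euclidean norm. Equivalently, the density h_{n,p}(θ) = c_{p,n} |θ^{p−1}|₂ of the surface measure ν_{p,n} with respect to the cone measure μ_{p,n}, with c_{p,n} = (∫ |θ^{p−1}|₂ dμ_{p,n})^{−1}, satisfies (∫ h_{n,p}² dμ_{p,n})^{1/2} ≤ (p+1)^{1/2 − 1/p}. -/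
open MeasureTheory Real

/-- The `ℓ_p`-norm on `ℝⁿ`. -/
noncomputable def lpNorm (p : ℝ) {n : ℕ} (x : Fin n → ℝ) : ℝ :=
  (∑ i, |x i| ^ p) ^ (1 / p)

/-- The cone probability measure `μ_{p,n}` on the `ℓ_p`-sphere: the pushforward of the
normalized Lebesgue measure on the `ℓ_p`-unit ball under radial projection `x ↦ x/|x|_p`. -/
noncomputable def coneMeasure (p : ℝ) (n : ℕ) : Measure (Fin n → ℝ) :=
  Measure.map (fun x => (lpNorm p x)⁻¹ • x)
    ((volume {x : Fin n → ℝ | lpNorm p x ≤ 1})⁻¹ •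
      volume.restrict {x : Fin n → ℝ | lpNorm p x ≤ 1})

/-- The entropy functional `Ent_μ(g) = ∫ g log g dμ - (∫ g dμ) log(∫ g dμ)`. -/
noncomputable def entropy {α : Type*} [MeasurableSpace α] (μ : Measure α) (g : α → ℝ) : ℝ :=
  (∫ x, g x * Real.log (g x) ∂μ) - (∫ x, g x ∂μ) * Real.log (∫ x, g x ∂μ)

theorem aux_J (p m : ℝ) (hp : 2 ≤ p) (hm : 0 ≤ m) :
    ∫ t : ℝ, |t| ^ m * exp (-|t| ^ p) = 2 / p * Gamma ((m + 1) / p) := by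
  rw [integral_comp_abs (f := fun t => t ^ m * exp (-t ^ p)),
    integral_rpow_mul_exp_neg_rpow (by linarith) (by linarith)]
  ring

theorem aux_prod (p : ℝ) (hp : 2 ≤ p) (n : ℕ) (m : Fin n → ℝ) (hm : ∀ i, 0 ≤ m i) :
    Integrable (fun x : Fin n → ℝ => ∏ k, (|x k| ^ m k * exp (-|x k| ^ p))) ∧
    ∫ x : Fin n → ℝ, ∏ k, (|x k| ^ m k * exp (-|x k| ^ p)) =
      ∏ k, (2 / p * Gamma ((m k + 1) / p)) := by
  have h : ∫ x : Fin n → ℝ, ∏ k, (|x k| ^ m k * exp (-|x k| ^ p)) =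
      ∏ k, (2 / p * Gamma ((m k + 1) / p)) := by
    rw [integral_fintype_prod_volume_eq_prod (fun k t => |t| ^ m k * exp (-|t| ^ p))]
    exact Finset.prod_congr rfl fun k _ => aux_J p _ hp (hm k)
  refine ⟨?_, h⟩
  by_contra hc
  rw [integral_undef hc] at h
  have : 0 < ∏ k, (2 / p * Gamma ((m k + 1) / p)) := by
    refine Finset.prod_pos fun k _ => ?_
    have := Gamma_pos_of_pos (s := (m k + 1) / p) (by have := hm k; positivity)
    positivity
  linarith

/-- joint second moments of `|x_i|^p` -/
theorem aux_M (p : ℝ) (hp : 2 ≤ p) (n : ℕ) (i j : Fin n) :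
    Integrable (fun x : Fin n → ℝ => |x i| ^ p * |x j| ^ p * exp (-∑ k, |x k| ^ p)) ∧
    ∫ x : Fin n → ℝ, |x i| ^ p * |x j| ^ p * exp (-∑ k, |x k| ^ p) =
      (2 / p * Gamma (1 / p)) ^ n * (p⁻¹ ^ 2 + if i = j then p⁻¹ else 0) := by
  have hp0 : 0 < p := by linarith
  have h := aux_prod p hp n (fun k => (if k = i then p else 0) + (if k = j then p else 0))
    (fun k => by positivity)
  have e : (fun x : Fin n → ℝ => |x i| ^ p * |x j| ^ p * exp (-∑ k, |x k| ^ p)) =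
      fun x : Fin n → ℝ => ∏ k, (|x k| ^ ((if k = i then p else 0) + (if k = j then p else 0)) *
        exp (-|x k| ^ p)) := by
    funext x
    rw [Finset.prod_mul_distrib, ← exp_sum, Finset.sum_neg_distrib]
    congr 1
    have : ∀ k, |x k| ^ ((if k = i then p else 0) + (if k = j then p else 0)) =
        (if k = i then |x k| ^ p else 1) * (if k = j then |x k| ^ p else 1) := by
      intro k
      rw [rpow_add_of_nonneg (abs_nonneg _) (by positivity) (by positivity)]
      congr 1 <;> split_ifs <;> simp
    simp only [this, Finset.prod_mul_distrib]
    simp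
  rw [e]
  refine ⟨h.1, h.2.trans ?_⟩
  have g1 : Gamma ((p + 1) / p) = p⁻¹ * Gamma (1 / p) := by
    rw [show (p + 1) / p = 1 / p + 1 by field_simp; ring, Gamma_add_one (by positivity)]; simp
  have g2 : Gamma ((p + p + 1) / p) = (p⁻¹ + 1) * p⁻¹ * Gamma (1 / p) := by
    rw [show (p + p + 1) / p = (p + 1) / p + 1 by field_simp; ring, Gamma_add_one (by positivity), g1]
    field_simp; ring
  by_cases hij : i = j
  · subst hij
    have : ∀ k, (2 / p * Gamma (((if k = i then p else 0) + (if k = i then p else 0) + 1) / p)) =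
        (2 / p * Gamma (1 / p)) * (if k = i then (p⁻¹ + 1) * p⁻¹ else 1) := by
      intro k
      split_ifs
      · rw [g2]; ring
      · simp
    simp only [this, Finset.prod_mul_distrib]
    simp only [Finset.prod_const, Finset.card_univ, Fintype.card_fin, Finset.prod_ite_eq', Finset.mem_univ, if_true]
    ring
  · have : ∀ k, (2 / p * Gamma (((if k = i then p else 0) + (if k = j then p else 0) + 1) / p)) =
        (2 / p * Gamma (1 / p)) * ((if k = i then p⁻¹ else 1) * (if k = j then p⁻¹ else 1)) := by
      intro k
      by_cases h1 : k = i
      · have h2 : k ≠ j := fun h => hij (h1.symm.trans h)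
        simp only [h1, hij, if_true, if_false, add_zero, g1]; ring
      · by_cases h2 : k = j
        · subst h2
          simp only [h1, if_true, if_false, zero_add, g1]; ring
        · simp [h1, h2]
    simp only [this, Finset.prod_mul_distrib]
    simp only [Finset.prod_const, Finset.card_univ, Fintype.card_fin, Finset.prod_ite_eq', Finset.mem_univ, if_true, hij, if_false]
    ring

theorem aux_moment (p : ℝ) (hp : 2 ≤ p) (n : ℕ) (hn : 0 < n) :
    (n : ENNReal) * ∫⁻ x : Fin n → ℝ, ENNReal.ofReal ((∑ i, |x i| ^ (2 * p)) * exp (-∑ k, |x k| ^ p))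
      ≤ ENNReal.ofReal (p + 1) *
      ∫⁻ x : Fin n → ℝ, ENNReal.ofReal ((∑ i, |x i| ^ p) ^ 2 * exp (-∑ k, |x k| ^ p)) ∧
    ∫⁻ x : Fin n → ℝ, ENNReal.ofReal ((∑ i, |x i| ^ p) ^ 2 * exp (-∑ k, |x k| ^ p)) ≠ 0 ∧
    ∫⁻ x : Fin n → ℝ, ENNReal.ofReal ((∑ i, |x i| ^ p) ^ 2 * exp (-∑ k, |x k| ^ p)) ≠ ⊤ := by
  have hp0 : 0 < p := by linarith
  have e1 : ∀ x : Fin n → ℝ, (∑ i, |x i| ^ (2 * p)) * exp (-∑ k, |x k| ^ p) =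
      ∑ i, |x i| ^ p * |x i| ^ p * exp (-∑ k, |x k| ^ p) := by
    intro x
    rw [Finset.sum_mul]
    refine Finset.sum_congr rfl fun i _ => ?_
    rw [two_mul, rpow_add_of_nonneg (abs_nonneg _) hp0.le hp0.le]
  have e2 : ∀ x : Fin n → ℝ, (∑ i, |x i| ^ p) ^ 2 * exp (-∑ k, |x k| ^ p) =
      ∑ i, ∑ j, |x i| ^ p * |x j| ^ p * exp (-∑ k, |x k| ^ p) := by
    intro x
    rw [sq, Finset.sum_mul_sum]
    simp only [Finset.sum_mul]
  have i1 : Integrable fun x : Fin n → ℝ =>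
      ∑ i, |x i| ^ p * |x i| ^ p * exp (-∑ k, |x k| ^ p) :=
    integrable_finsetSum _ fun i _ => (aux_M p hp n i i).1
  have i2 : Integrable fun x : Fin n → ℝ =>
      ∑ i, ∑ j, |x i| ^ p * |x j| ^ p * exp (-∑ k, |x k| ^ p) :=
    integrable_finsetSum _ fun i _ => integrable_finsetSum _ fun j _ => (aux_M p hp n i j).1
  simp only [e1, e2]
  rw [← ofReal_integral_eq_lintegral_ofReal i1 (.of_forall fun x => by positivity),
    ← ofReal_integral_eq_lintegral_ofReal i2 (.of_forall fun x => by positivity),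
    integral_finsetSum _ fun i _ => (aux_M p hp n i i).1,
    integral_finsetSum _ fun i _ => integrable_finsetSum _ fun j _ => (aux_M p hp n i j).1]
  simp only [fun i => integral_finsetSum (Finset.univ : Finset (Fin n)) (f := fun j (x : Fin n → ℝ) => |x i| ^ p * |x j| ^ p * exp (-∑ k, |x k| ^ p)) fun j _ => (aux_M p hp n i j).1]
  simp only [fun i j => (aux_M p hp n i j).2]
  have hC : 0 < (2 / p * Gamma p⁻¹) ^ n := by
    have := Gamma_pos_of_pos (s := p⁻¹) (by positivity)
    positivity
  refine ⟨?_, ?_, ENNReal.ofReal_ne_top⟩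
  · rw [← ENNReal.ofReal_natCast, ← ENNReal.ofReal_mul (by positivity),
      ← ENNReal.ofReal_mul (by positivity)]
    apply ENNReal.ofReal_le_ofReal
    simp only [← Finset.mul_sum, Finset.sum_add_distrib]
    simp
    have : (n : ℝ) * (n * (p ^ 2)⁻¹ + n * p⁻¹) ≤ (p + 1) * (n * (n * (p ^ 2)⁻¹) + n * p⁻¹) := by
      have : (p + 1) * (n * (n * (p ^ 2)⁻¹) + n * p⁻¹) - n * (n * (p ^ 2)⁻¹ + n * p⁻¹)
          = (p + 1) * (n * p⁻¹) := by field_simp; ring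
      have h : 0 ≤ (p + 1) * (n * p⁻¹) := by positivity
      linarith
    nlinarith [mul_le_mul_of_nonneg_left this hC.le]
  · rw [← pos_iff_ne_zero, ENNReal.ofReal_pos]
    simp only [← Finset.mul_sum, Finset.sum_add_distrib]
    simp
    have hn' : (0 : ℝ) < n := by exact_mod_cast hn
    positivity
theorem aux_radial (p : ℝ) (hp : 2 ≤ p) (n : ℕ) (hn : 0 < n) (S : (Fin n → ℝ) → ℝ)
    (hS : S = fun x => ∑ i, |x i| ^ p)
    (hB : volume {x | S x ≤ 1} ≠ ⊤)
    (F : (Fin n → ℝ) → ENNReal) (hF : Measurable F) (hF1 : ∀ x, F x ≤ 1)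
    (hF0 : ∀ (r : ℝ) x, 0 < r → F (r • x) = F x) (φ : ℝ → ENNReal) (hφ : Measurable φ) :
    volume {x | S x ≤ 1} * ∫⁻ x, F x * φ (S x) = (∫⁻ x in {x | S x ≤ 1}, F x) * ∫⁻ x, φ (S x) := by
  have hp0 : 0 < p := by linarith
  have : Nonempty (Fin n) := ⟨⟨0, hn⟩⟩
  have hSm : Measurable S := by rw [hS]; fun_prop
  have hms : ∀ t, MeasurableSet {x | S x ≤ t} := fun t => hSm measurableSet_Iic
  have key : ∀ G : (Fin n → ℝ) → ENNReal, Measurable G → (∀ (r : ℝ) x, 0 < r → G (r • x) = G x) →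
      ∀ t : ℝ, 0 < t → ∫⁻ x in {x | S x ≤ t}, G x =
        ENNReal.ofReal ((t ^ (1 / p)) ^ n) * ∫⁻ x in {x | S x ≤ 1}, G x := by
    intro G hG hG0 t ht
    have hr : 0 < t ^ (1 / p) := by positivity
    set r := t ^ (1 / p) with hrdef
    have hrp : r ^ p = t := by
      rw [hrdef, ← rpow_mul ht.le, one_div_mul_cancel hp0.ne', rpow_one]
    have hm := Measure.map_addHaar_smul (volume : Measure (Fin n → ℝ)) hr.ne'
    have h1 : ∫⁻ x, ({x | S x ≤ t}.indicator G) x ∂(Measure.map (r • ·) (volume : Measure (Fin n → ℝ)))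
        = ∫⁻ x in {x | S x ≤ 1}, G x := by
      rw [lintegral_map (hG.indicator (hms t)) (by fun_prop), ← lintegral_indicator (hms 1)]
      refine lintegral_congr fun x => ?_
      have : S (r • x) = t * S x := by
        simp only [hS, Pi.smul_apply, smul_eq_mul, abs_mul, abs_of_pos hr, Finset.mul_sum]
        refine Finset.sum_congr rfl fun i _ => ?_
        rw [mul_rpow hr.le (abs_nonneg _), hrp]
      simp only [Set.indicator, Set.mem_ofPred_eq, this, hG0 r x hr]
      have : t * S x ≤ t ↔ S x ≤ 1 := by
        constructor <;> intro h <;> nlinarith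
      simp only [this]
    rw [hm, lintegral_smul_measure, lintegral_indicator (hms t)] at h1
    rw [← h1, smul_eq_mul, ← mul_assoc, ← ENNReal.ofReal_mul (by positivity)]
    simp only [Module.finrank_fintype_fun_eq_card, Fintype.card_fin]
    rw [abs_of_pos (by positivity), mul_inv_cancel₀ (by positivity)]
    simp
  have key0 : ∀ t : ℝ, t ≤ 0 → volume {x | S x ≤ t} = 0 := by
    intro t ht
    refine measure_mono_null (t := {0}) ?_ (by simp)
    intro x hx
    have hx : S x ≤ t := hx
    rw [hS] at hx
    have h0 : ∑ i, |x i| ^ p = 0 := le_antisymm (hx.trans ht) (by positivity)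
    rw [Finset.sum_eq_zero_iff_of_nonneg (fun i _ => by positivity)] at h0
    ext i
    have := h0 i (Finset.mem_univ _)
    rw [rpow_eq_zero (abs_nonneg _) hp0.ne'] at this
    simpa using this
  have hI : ∫⁻ x in {x | S x ≤ 1}, F x ≤ volume {x | S x ≤ 1} := by
    calc _ ≤ ∫⁻ x in {x | S x ≤ 1}, 1 := lintegral_mono hF1
      _ = _ := by simp
  have hI' : ∫⁻ x in {x | S x ≤ 1}, F x ≠ ⊤ := ne_top_of_le_ne_top hB hI
  have hvol : ∀ t : ℝ, 0 < t → volume {x | S x ≤ t} =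
      ENNReal.ofReal ((t ^ (1 / p)) ^ n) * volume {x | S x ≤ 1} := by
    intro t ht
    simpa using key (fun _ => 1) measurable_const (fun _ _ _ => rfl) t ht
  set m1 := volume {x | S x ≤ 1} • Measure.map S (volume.withDensity F) with hm1
  set m2 := (∫⁻ x in {x | S x ≤ 1}, F x) • Measure.map S volume with hm2
  have hIic : ∀ t, m1 (Set.Iic t) = m2 (Set.Iic t) := by
    intro t
    simp only [hm1, hm2, Measure.smul_apply, smul_eq_mul, Measure.map_apply hSm measurableSet_Iic]
    rw [withDensity_apply _ (hSm measurableSet_Iic)]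
    change _ * ∫⁻ x in {x | S x ≤ t}, F x = _ * volume {x | S x ≤ t}
    rcases le_or_gt t 0 with ht | ht
    · rw [key0 t ht, Measure.restrict_eq_zero.2 (key0 t ht)]; simp
    · rw [key F hF hF0 t ht, hvol t ht]; ring
  have hfin : ∀ t, m2 (Set.Iic t) ≠ ⊤ := by
    intro t
    simp only [hm2, Measure.smul_apply, smul_eq_mul, Measure.map_apply hSm measurableSet_Iic]
    refine ENNReal.mul_ne_top hI' ?_
    change volume {x | S x ≤ t} ≠ ⊤
    rcases le_or_gt t 0 with ht | ht
    · rw [key0 t ht]; simp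
    · rw [hvol t ht]; exact ENNReal.mul_ne_top (by simp) hB
  have hmm : m1 = m2 := by
    refine Measure.ext_of_Ioc' m1 m2 ?_ ?_
    · intro a b _
      refine ne_top_of_le_ne_top (hfin b) ?_
      rw [← hIic]
      exact measure_mono Set.Ioc_subset_Iic_self
    · intro a b hab
      rw [show Set.Ioc a b = Set.Iic b \ Set.Iic a by ext; simp [and_comm], measure_sdiff (Set.Iic_subset_Iic.2 hab.le)
        measurableSet_Iic.nullMeasurableSet (by rw [hIic]; exact hfin a),
        measure_sdiff (Set.Iic_subset_Iic.2 hab.le)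
        measurableSet_Iic.nullMeasurableSet (hfin a), hIic, hIic]
  have := congrArg (fun m => ∫⁻ s, φ s ∂m) hmm
  simp only [hm1, hm2, lintegral_smul_measure, smul_eq_mul, lintegral_map hφ hSm] at this
  rw [lintegral_withDensity_eq_lintegral_mul _ hF (g := fun x => φ (S x)) (hφ.comp hSm)] at this
  exact this
theorem aux_final (p : ℝ) (hp : 2 ≤ p) (n : ℕ) (hn : 0 < n) (μ : Measure (Fin n → ℝ))
    [IsProbabilityMeasure μ] (hae : ∀ᵐ θ ∂μ, ∑ i, |θ i| ^ p = 1)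
    (hmom : ∫ θ, ∑ i, |θ i| ^ (2 * p) ∂μ ≤ (p + 1) / n) :
    0 < ∫ θ, (∑ j, |θ j| ^ (2 * p - 2)) ^ ((1 : ℝ) / 2) ∂μ ∧
    (∫ θ, ∑ j, |θ j| ^ (2 * p - 2) ∂μ) ^ ((1 : ℝ) / 2) ≤
      (p + 1) ^ ((1 : ℝ) / 2 - 1 / p) *
        ∫ θ, (∑ j, |θ j| ^ (2 * p - 2)) ^ ((1 : ℝ) / 2) ∂μ := by
  have hp0 : 0 < p := by linarith
  have hn' : (0 : ℝ) < n := by exact_mod_cast hn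
  have hle : ∀ᵐ θ ∂μ, ∀ i, |θ i| ≤ 1 := by
    filter_upwards [hae] with θ h i
    have h1 : |θ i| ^ p ≤ 1 := by
      rw [← h]
      exact Finset.single_le_sum (f := fun i => |θ i| ^ p) (fun j _ => by positivity)
        (Finset.mem_univ i)
    by_contra hc
    push Not at hc
    linarith [one_lt_rpow hc hp0]
  have hbd : ∀ q : ℝ, 0 ≤ q → ∀ᵐ θ ∂μ, ∑ j, |θ j| ^ q ≤ (n : ℝ) := by
    intro q hq
    filter_upwards [hle] with θ h
    calc ∑ j, |θ j| ^ q ≤ ∑ j : Fin n, (1 : ℝ) :=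
          Finset.sum_le_sum fun j _ => rpow_le_one (abs_nonneg _) (h j) hq
      _ = n := by simp
  have hint : ∀ q : ℝ, 0 ≤ q → Integrable (fun θ => ∑ j, |θ j| ^ q) μ := by
    intro q hq
    refine Integrable.of_bound (Measurable.aestronglyMeasurable (by fun_prop)) n ?_
    filter_upwards [hbd q hq] with θ h
    rwa [norm_of_nonneg (by positivity)]
  have hint2 : Integrable (fun θ => (∑ j, |θ j| ^ (2 * p - 2)) ^ ((1 : ℝ) / 2)) μ := by
    refine Integrable.of_bound (Measurable.aestronglyMeasurable (by fun_prop))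
      ((n : ℝ) ^ ((1 : ℝ) / 2)) ?_
    filter_upwards [hbd (2 * p - 2) (by linarith)] with θ h
    rw [norm_of_nonneg (by positivity)]
    exact rpow_le_rpow (by positivity) h (by norm_num)
  set α : ℝ := (p - 2) / p with hα
  have hα0 : 0 ≤ α := div_nonneg (by linarith) hp0.le
  have hα1 : α ≤ 1 := by rw [hα, div_le_one hp0]; linarith
  have hpα : p * α = p - 2 := by rw [hα]; field_simp
  set c : ℝ := (p + 1) / n with hc
  have hc0 : 0 < c := by positivity
  -- upper bound
  have hup : ∫ θ, ∑ j, |θ j| ^ (2 * p - 2) ∂μ ≤ c ^ α := by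
    have h1 : ∀ᵐ θ ∂μ, ∑ j, |θ j| ^ (2 * p - 2) ≤
        c ^ (α - 1) * α * (∑ j, |θ j| ^ (2 * p)) + c ^ (α - 1) * ((1 - α) * c) := by
      filter_upwards [hae] with θ h
      have h2 : ∀ j, |θ j| ^ (2 * p - 2) ≤
          c ^ (α - 1) * α * |θ j| ^ (2 * p) + c ^ (α - 1) * ((1 - α) * c) * |θ j| ^ p := by
        intro j
        have hg := geom_mean_le_arith_mean2_weighted hα0 (sub_nonneg.2 hα1)
          (rpow_nonneg (abs_nonneg (θ j)) p) hc0.le (by ring)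
        rw [← rpow_mul (abs_nonneg _), hpα] at hg
        have e1 : |θ j| ^ (2 * p - 2) = |θ j| ^ p * |θ j| ^ (p - 2) := by
          rw [← rpow_add_of_nonneg (abs_nonneg _) hp0.le (by linarith)]; ring_nf
        have e2 : |θ j| ^ (2 * p) = |θ j| ^ p * |θ j| ^ p := by
          rw [← rpow_add_of_nonneg (abs_nonneg _) hp0.le hp0.le]; ring_nf
        have e3 : c ^ (α - 1) * c ^ (1 - α) = 1 := by
          rw [← rpow_add hc0]; simp
        have hk : 0 ≤ |θ j| ^ p * c ^ (α - 1) := by positivity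
        have := mul_le_mul_of_nonneg_left hg hk
        rw [e1, e2]
        calc |θ j| ^ p * |θ j| ^ (p - 2)
            = |θ j| ^ p * |θ j| ^ (p - 2) * (c ^ (α - 1) * c ^ (1 - α)) := by rw [e3, mul_one]
          _ = |θ j| ^ p * c ^ (α - 1) * (|θ j| ^ (p - 2) * c ^ (1 - α)) := by ring
          _ ≤ _ := this
          _ = _ := by ring
      calc _ ≤ ∑ j, (c ^ (α - 1) * α * |θ j| ^ (2 * p) +
            c ^ (α - 1) * ((1 - α) * c) * |θ j| ^ p) := Finset.sum_le_sum fun j _ => h2 j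
        _ = _ := by rw [Finset.sum_add_distrib, ← Finset.mul_sum, ← Finset.mul_sum, h, mul_one]
    calc _ ≤ ∫ θ, (c ^ (α - 1) * α * (∑ j, |θ j| ^ (2 * p)) +
            c ^ (α - 1) * ((1 - α) * c)) ∂μ :=
          integral_mono_ae (hint _ (by linarith))
            (((hint _ (by linarith)).const_mul _).add (integrable_const _)) h1
      _ = c ^ (α - 1) * α * (∫ θ, ∑ j, |θ j| ^ (2 * p) ∂μ) + c ^ (α - 1) * ((1 - α) * c) := by
          rw [integral_add ((hint _ (by linarith)).const_mul _) (integrable_const _),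
            integral_const_mul]
          simp
      _ ≤ c ^ (α - 1) * α * c + c ^ (α - 1) * ((1 - α) * c) := by gcongr
      _ = c ^ (α - 1) * c := by ring
      _ = c ^ α := by
          nth_rw 2 [← rpow_one c]
          rw [← rpow_add hc0]; ring_nf
  -- lower bound
  have hlow : ((n : ℝ) ^ α)⁻¹ ^ ((1 : ℝ) / 2) ≤
      ∫ θ, (∑ j, |θ j| ^ (2 * p - 2)) ^ ((1 : ℝ) / 2) ∂μ := by
    have h1 : ∀ᵐ θ ∂μ, ((n : ℝ) ^ α)⁻¹ ^ ((1 : ℝ) / 2) ≤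
        (∑ j, |θ j| ^ (2 * p - 2)) ^ ((1 : ℝ) / 2) := by
      filter_upwards [hae] with θ h
      refine rpow_le_rpow (by positivity) ?_ (by norm_num)
      have := rpow_sum_le_const_mul_sum_rpow_of_nonneg Finset.univ
        (f := fun j => |θ j| ^ p) (p := 1 + α) (by linarith) (fun j _ => by positivity)
      simp only [h, one_rpow, Finset.card_univ, Fintype.card_fin, add_sub_cancel_left,
        ← rpow_mul (abs_nonneg _)] at this
      rw [show p * (1 + α) = 2 * p - 2 by rw [mul_add, hpα]; ring] at this
      rw [inv_le_iff_one_le_mul₀ (by positivity), mul_comm]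
      exact this
    calc _ = ∫ θ, ((n : ℝ) ^ α)⁻¹ ^ ((1 : ℝ) / 2) ∂μ := by simp
      _ ≤ _ := integral_mono_ae (integrable_const _) hint2 h1
  refine ⟨lt_of_lt_of_le (by positivity) hlow, ?_⟩
  have hβ : (1 : ℝ) / 2 - 1 / p = α * (1 / 2) := by rw [hα]; field_simp
  calc _ ≤ (c ^ α) ^ ((1 : ℝ) / 2) := by
        refine rpow_le_rpow (integral_nonneg fun θ => by positivity) hup (by norm_num)
    _ = (p + 1) ^ ((1 : ℝ) / 2 - 1 / p) * ((n : ℝ) ^ α)⁻¹ ^ ((1 : ℝ) / 2) := by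
        rw [hβ, rpow_mul (by positivity), ← mul_rpow (by positivity) (by positivity), hc,
          div_rpow (by positivity) (by positivity)]
        rfl
    _ ≤ _ := by gcongr
theorem aux_cone (p : ℝ) (hp : 2 ≤ p) (n : ℕ) (hn : 0 < n) :
    IsProbabilityMeasure (coneMeasure p n) ∧ (∀ᵐ θ ∂(coneMeasure p n), ∑ i, |θ i| ^ p = 1) ∧
    ∫ θ, ∑ i, |θ i| ^ (2 * p) ∂(coneMeasure p n) ≤ (p + 1) / n := by
  have hp0 : 0 < p := by linarith
  have hn' : (0 : ℝ) < n := by exact_mod_cast hn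
  have : Nonempty (Fin n) := ⟨⟨0, hn⟩⟩
  set S : (Fin n → ℝ) → ℝ := fun x => ∑ i, |x i| ^ p with hS
  have hS0 : ∀ x, 0 ≤ S x := fun x => by simp only [hS]; positivity
  have hBeq : {x : Fin n → ℝ | _root_.lpNorm p x ≤ 1} = {x | S x ≤ 1} := by
    ext x
    change S x ^ (1 / p) ≤ 1 ↔ S x ≤ 1
    constructor
    · intro h
      by_contra hc
      push Not at hc
      linarith [one_lt_rpow hc (z := 1 / p) (by positivity)]
    · intro h
      exact rpow_le_one (hS0 x) h (by positivity)
  have hvol := volume_sum_rpow_le (ι := Fin n) (p := p) (by linarith) 1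
  change volume {x : Fin n → ℝ | _root_.lpNorm p x ≤ 1} = _ at hvol
  have hB : volume {x | S x ≤ 1} ≠ ⊤ := by
    rw [← hBeq, hvol]; exact ENNReal.mul_ne_top (by simp) (by simp)
  have hB0 : volume {x | S x ≤ 1} ≠ 0 := by
    rw [← hBeq, hvol]
    have h1 := Gamma_pos_of_pos (s := 1 / p + 1) (by positivity)
    have h2 := Gamma_pos_of_pos (s := (n : ℝ) / p + 1) (by positivity)
    simp only [ENNReal.ofReal_one, one_pow, one_mul, Fintype.card_fin]
    rw [← pos_iff_ne_zero, ENNReal.ofReal_pos]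
    positivity
  set T : (Fin n → ℝ) → (Fin n → ℝ) := fun x => (_root_.lpNorm p x)⁻¹ • x with hT
  have hTm : Measurable T := by
    simp only [hT, _root_.lpNorm]; fun_prop
  have hTp : ∀ x i, |T x i| ^ p = (S x)⁻¹ * |x i| ^ p := by
    intro x i
    have hN : 0 ≤ _root_.lpNorm p x := rpow_nonneg (hS0 x) _
    simp only [hT, Pi.smul_apply, smul_eq_mul, abs_mul, abs_inv, abs_of_nonneg hN]
    rw [mul_rpow (by positivity) (abs_nonneg _), inv_rpow hN]
    congr 2
    change (S x ^ (1 / p)) ^ p = S x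
    rw [← rpow_mul (hS0 x), one_div_mul_cancel hp0.ne', rpow_one]
  have h2p : ∀ t : ℝ, |t| ^ (2 * p) = |t| ^ p * |t| ^ p := fun t => by
    rw [← rpow_add_of_nonneg (abs_nonneg _) hp0.le hp0.le]; ring_nf
  have hT2 : ∀ x, ∑ i, |T x i| ^ (2 * p) = (S x ^ 2)⁻¹ * ∑ i, |x i| ^ (2 * p) := by
    intro x
    rw [Finset.mul_sum]
    refine Finset.sum_congr rfl fun i _ => ?_
    rw [h2p, h2p, hTp, sq, mul_inv]; ring
  have hsq : ∀ x : Fin n → ℝ, ∑ i, |x i| ^ (2 * p) ≤ S x ^ 2 := by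
    intro x
    rw [sq]
    nth_rw 1 [hS]
    rw [Finset.sum_mul]
    refine Finset.sum_le_sum fun i _ => ?_
    rw [h2p]
    refine mul_le_mul_of_nonneg_left ?_ (by positivity)
    exact Finset.single_le_sum (f := fun i => |x i| ^ p) (fun j _ => by positivity)
        (Finset.mem_univ i)
  have hcone : coneMeasure p n = Measure.map T ((volume {x | S x ≤ 1})⁻¹ •
      volume.restrict {x | S x ≤ 1}) := by
    rw [coneMeasure, hBeq]
  rw [hcone]
  refine ⟨?_, ?_, ?_⟩
  · have : IsProbabilityMeasure ((volume {x | S x ≤ 1})⁻¹ • volume.restrict {x | S x ≤ 1}) :=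
      ⟨by simp [ENNReal.inv_mul_cancel hB0 hB]⟩
    exact Measure.isProbabilityMeasure_map hTm.aemeasurable
  · rw [ae_map_iff hTm.aemeasurable (measurableSet_eq_fun (by fun_prop) (by fun_prop))]
    refine Measure.ae_smul_measure (ae_restrict_of_ae ?_) _
    have h0 : ∀ᵐ x : Fin n → ℝ, x ≠ 0 := by
      simp [ae_iff]
    filter_upwards [h0] with x hx
    simp only [hTp, ← Finset.mul_sum]
    refine inv_mul_cancel₀ ?_
    intro h
    rw [hS] at h
    simp only at h
    rw [Finset.sum_eq_zero_iff_of_nonneg (fun i _ => by positivity)] at h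
    apply hx
    ext i
    have := h i (Finset.mem_univ _)
    rw [rpow_eq_zero (abs_nonneg _) hp0.ne'] at this
    simpa using this
  · rw [integral_eq_lintegral_of_nonneg_ae (.of_forall fun θ => by positivity)
      (Measurable.aestronglyMeasurable (by fun_prop))]
    refine ENNReal.toReal_le_of_le_ofReal (by positivity) ?_
    rw [lintegral_map (by fun_prop) hTm, lintegral_smul_measure, smul_eq_mul]
    set F : (Fin n → ℝ) → ENNReal := fun x => ENNReal.ofReal (∑ i, |T x i| ^ (2 * p)) with hF
    have hFm : Measurable F := by
      refine ENNReal.measurable_ofReal.comp ?_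
      exact (show Measurable fun y : Fin n → ℝ => ∑ i, |y i| ^ (2 * p) by fun_prop).comp hTm
    have hF1 : ∀ x, F x ≤ 1 := by
      intro x
      rw [hF]
      simp only [hT2]
      rw [ENNReal.ofReal_le_one]
      exact inv_mul_le_one_of_le₀ (hsq x) (by positivity)
    have hF0 : ∀ (r : ℝ) x, 0 < r → F (r • x) = F x := by
      intro r x hr
      simp only [hF, hT2]
      congr 1
      have e1 : S (r • x) = r ^ p * S x := by
        simp only [hS, Pi.smul_apply, smul_eq_mul, abs_mul, abs_of_pos hr, Finset.mul_sum]
        exact Finset.sum_congr rfl fun i _ => mul_rpow hr.le (abs_nonneg _)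
      have e2 : ∑ i, |(r • x) i| ^ (2 * p) = (r ^ p) ^ 2 * ∑ i, |x i| ^ (2 * p) := by
        simp only [Pi.smul_apply, smul_eq_mul, abs_mul, abs_of_pos hr, Finset.mul_sum]
        refine Finset.sum_congr rfl fun i _ => ?_
        rw [mul_rpow hr.le (abs_nonneg _), ← abs_of_pos hr, h2p, sq]
      rw [e1, e2, mul_pow, mul_inv]
      have : (r ^ p) ^ 2 ≠ 0 := by positivity
      field_simp
    have hrad := aux_radial p hp n hn S hS hB F hFm hF1 hF0
      (fun s => ENNReal.ofReal (s ^ 2 * exp (-s))) (by fun_prop)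
    have hFφ : ∀ x, F x * ENNReal.ofReal (S x ^ 2 * exp (-S x)) =
        ENNReal.ofReal ((∑ i, |x i| ^ (2 * p)) * exp (-∑ k, |x k| ^ p)) := by
      intro x
      simp only [hF, hT2]
      rw [← ENNReal.ofReal_mul (by positivity)]
      congr 1
      change _ = (∑ i, |x i| ^ (2 * p)) * exp (-S x)
      rw [← mul_assoc]
      congr 1
      by_cases h : S x = 0
      · have h1 := hsq x
        have h2 : 0 ≤ ∑ i, |x i| ^ (2 * p) := by positivity
        rw [h] at h1 ⊢
        norm_num at h1 ⊢
        linarith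
      · field_simp
    simp only [hFφ] at hrad
    obtain ⟨hm, hK0, hK⟩ := aux_moment p hp n hn
    change _ = _ * ∫⁻ x : Fin n → ℝ, ENNReal.ofReal ((∑ i, |x i| ^ p) ^ 2 * exp (-∑ k, |x k| ^ p))
      at hrad
    set K := ∫⁻ x : Fin n → ℝ, ENNReal.ofReal ((∑ i, |x i| ^ p) ^ 2 * exp (-∑ k, |x k| ^ p))
    set L := ∫⁻ x : Fin n → ℝ, ENNReal.ofReal ((∑ i, |x i| ^ (2 * p)) * exp (-∑ k, |x k| ^ p))
    set V := volume {x | S x ≤ 1}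
    set I := ∫⁻ x in {x | S x ≤ 1}, F x
    change V⁻¹ * I ≤ _
    rw [ENNReal.ofReal_div_of_pos hn', ENNReal.ofReal_natCast,
      ENNReal.le_div_iff_mul_le (.inl (by simp; omega)) (.inl (by simp))]
    rw [← ENNReal.mul_le_mul_iff_left hK0 hK]
    calc V⁻¹ * I * n * K = V⁻¹ * n * (I * K) := by ring
      _ = V⁻¹ * V * (n * L) := by rw [← hrad]; ring
      _ = n * L := by rw [ENNReal.inv_mul_cancel hB0 hB, one_mul]
      _ ≤ _ := hm
/-- Lemma 4.4: the `L²(μ_{p,n})`-bound on `|θ^{p-1}|₂`, equivalently on the density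
`h_{n,p} = c_{p,n} |θ^{p-1}|₂` of the surface measure with respect to the cone measure.
Note that `|θ^{p-1}|₂ = (∑_j |θ_j|^{2p-2})^{1/2}`. -/
theorem density_L2_bound (p : ℝ) (hp : 2 ≤ p) (n : ℕ) :
    (∫ θ, ∑ j, |θ j| ^ (2 * p - 2) ∂(coneMeasure p n)) ^ ((1 : ℝ) / 2) ≤
      (p + 1) ^ ((1 : ℝ) / 2 - 1 / p) *
        ∫ θ, (∑ j, |θ j| ^ (2 * p - 2)) ^ ((1 : ℝ) / 2) ∂(coneMeasure p n) ∧
    (∫ θ, ((∫ θ', (∑ j, |θ' j| ^ (2 * p - 2)) ^ ((1 : ℝ) / 2) ∂(coneMeasure p n))⁻¹ *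
        (∑ j, |θ j| ^ (2 * p - 2)) ^ ((1 : ℝ) / 2)) ^ 2 ∂(coneMeasure p n)) ^ ((1 : ℝ) / 2) ≤
      (p + 1) ^ ((1 : ℝ) / 2 - 1 / p) := by
  
  rcases Nat.eq_zero_or_pos n with rfl | hn
  · have : 0 ≤ (p + 1) ^ ((1 : ℝ) / 2 - 1 / p) := rpow_nonneg (by linarith) _
    simpa using this
  obtain ⟨hprob, hae, hmom⟩ := aux_cone p hp n hn
  obtain ⟨h1, h2⟩ := aux_final p hp n hn _ hae hmom
  refine ⟨h2, ?_⟩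
  set A := ∫ θ, (∑ j, |θ j| ^ (2 * p - 2)) ^ ((1 : ℝ) / 2) ∂(coneMeasure p n)
  have e : ∀ θ : Fin n → ℝ, (A⁻¹ * (∑ j, |θ j| ^ (2 * p - 2)) ^ ((1 : ℝ) / 2)) ^ 2 =
      (A⁻¹) ^ 2 * ∑ j, |θ j| ^ (2 * p - 2) := by
    intro θ
    have h0 : 0 ≤ ∑ j, |θ j| ^ (2 * p - 2) := by positivity
    rw [mul_pow, ← Real.sqrt_eq_rpow, Real.sq_sqrt h0]
  simp only [e]
  rw [integral_const_mul, mul_rpow (by positivity) (integral_nonneg fun θ => by positivity),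
    ← Real.sqrt_eq_rpow, Real.sqrt_sq (by positivity), inv_mul_le_iff₀ h1, mul_comm A]
  exact h2
end
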